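/- arXiv:1711.01516 — 3 statements merged into one kernel-verified Lean document; each statement's English description precedes it below -/
import Mathlib

section
/- Let S be a set of primes having natural density d(S), and suppose there exist constants α > 0, C > 0, M > 0 such that for all x > M, |π_S(x)/π(x) − d(S)| ≤ C·x^{−α}. Then S is a regular set of primes, i.e. ∑_{p∈S} p^{−z} − d(S)·log(1/(z−1)) extends holomorphically to Re(z) ≥ 1. -/
open Filter Topology Set Complex

lemma glue_aux (K : ℂ → ℂ) (hK : AnalyticOnNhd ℂ K {z : ℂ | 1 < z.re})
    (hloc : ∀ y : ℝ, ∃ r > 0, ∃ L : ℂ → ℂ,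
      AnalyticOnNhd ℂ L (Metric.ball (1 + y * I) r) ∧
      ∀ w ∈ Metric.ball (1 + y * I : ℂ) r, 1 < w.re → L w = K w) :
    ∃ g : ℂ → ℂ, AnalyticOnNhd ℂ g {z : ℂ | 1 ≤ z.re} ∧ ∀ z : ℂ, 1 < z.re → g z = K z := by
  classical
  choose r hr L hL hLK using hloc
  have hopen : IsOpen {z : ℂ | 1 < z.re} := isOpen_lt continuous_const Complex.continuous_re
  -- uniqueness
  have huniq : ∀ (y y' : ℝ) (w : ℂ), w ∈ Metric.ball (1 + y * I : ℂ) (r y) →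
      w ∈ Metric.ball (1 + y' * I : ℂ) (r y') → w.re ≤ 1 → L y w = L y' w := by
    intro y y' w hw hw' hre
    set U := Metric.ball (1 + y * I : ℂ) (r y) ∩ Metric.ball (1 + y' * I : ℂ) (r y') with hU
    have hUo : IsOpen U := Metric.isOpen_ball.inter Metric.isOpen_ball
    have hUc : IsPreconnected U :=
      ((convex_ball _ _).inter (convex_ball _ _)).isPreconnected
    have hproj : ∀ v : ℝ, w ∈ Metric.ball (1 + v * I : ℂ) (r v) →
        (1 + w.im * I : ℂ) ∈ Metric.ball (1 + v * I : ℂ) (r v) := by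
      intro v hv
      rw [Metric.mem_ball, dist_eq_norm] at hv ⊢
      refine lt_of_le_of_lt ?_ hv
      have e1 : (1 + w.im * I - (1 + v * I) : ℂ) = ((w - (1 + v * I)).im : ℝ) * I := by
        apply Complex.ext <;> simp
      rw [e1, norm_mul, Complex.norm_I, mul_one, Complex.norm_real]
      exact Complex.abs_im_le_norm _
    have hc : (1 + w.im * I : ℂ) ∈ U := ⟨hproj _ hw, hproj _ hw'⟩
    obtain ⟨ε, hε, hball⟩ := Metric.isOpen_iff.1 hUo _ hc
    have hp : (1 + w.im * I + (ε / 2 : ℝ) : ℂ) ∈ U := by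
      apply hball
      rw [Metric.mem_ball, dist_eq_norm, add_sub_cancel_left, Complex.norm_real,
        Real.norm_eq_abs, abs_of_pos (by positivity)]
      linarith
    have hpre : 1 < (1 + w.im * I + (ε / 2 : ℝ) : ℂ).re := by
      simp; positivity
    refine AnalyticOnNhd.eqOn_of_preconnected_of_eventuallyEq
      ((hL y).mono inter_subset_left) ((hL y').mono inter_subset_right) hUc hp ?_ ⟨hw, hw'⟩
    filter_upwards [hUo.mem_nhds hp, hopen.mem_nhds hpre] with v hv hv'
    rw [hLK y v hv.1 hv', hLK y' v hv.2 hv']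
  let g : ℂ → ℂ := fun w => if 1 < w.re then K w else
    if h : ∃ y : ℝ, w ∈ Metric.ball (1 + y * I : ℂ) (r y) then L h.choose w else 0
  have hg : ∀ (y : ℝ) (w : ℂ), w ∈ Metric.ball (1 + y * I : ℂ) (r y) → g w = L y w := by
    intro y w hw
    by_cases h1 : 1 < w.re
    · simp only [g, if_pos h1]
      exact (hLK y w hw h1).symm
    · have h : ∃ y : ℝ, w ∈ Metric.ball (1 + y * I : ℂ) (r y) := ⟨y, hw⟩
      simp only [g, if_neg h1, dif_pos h]
      exact huniq _ _ w h.choose_spec hw (not_lt.1 h1)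
  refine ⟨g, ?_, fun z hz => if_pos hz⟩
  intro z hz
  rcases lt_or_eq_of_le (show 1 ≤ z.re from hz) with h | h
  · refine (hK z h).congr ?_
    filter_upwards [hopen.mem_nhds h] with w hw
    exact (if_pos hw).symm
  · have hzc : z = 1 + z.im * I := by
      apply Complex.ext <;> simp [← h]
    have hzb : z ∈ Metric.ball (1 + z.im * I : ℂ) (r z.im) := by
      rw [← hzc]; exact Metric.mem_ball_self (hr _)
    refine (hL z.im z hzb).congr ?_
    filter_upwards [Metric.isOpen_ball.mem_nhds hzb] with w hw
    exact (hg _ _ hw).symm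

/-- Extending a logarithm of a nonvanishing function. -/
lemma log_ext_aux (K F : ℂ → ℂ) (hK : AnalyticOnNhd ℂ K {z : ℂ | 1 < z.re})
    (hF : Differentiable ℂ F) (hF0 : ∀ z : ℂ, 1 ≤ z.re → F z ≠ 0)
    (hKF : ∀ z : ℂ, 1 < z.re → exp (K z) = F z) :
    ∃ g : ℂ → ℂ, AnalyticOnNhd ℂ g {z : ℂ | 1 ≤ z.re} ∧ ∀ z : ℂ, 1 < z.re → g z = K z := by
  have hopen : IsOpen {z : ℂ | 1 < z.re} := isOpen_lt continuous_const Complex.continuous_re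
  refine glue_aux K hK fun y => ?_
  set c : ℂ := 1 + y * I with hc
  have hFc : F c ≠ 0 := hF0 c (by simp [hc])
  have hV : ∀ᶠ w in 𝓝 c, F w / F c ∈ slitPlane := by
    have : ContinuousAt (fun w => F w / F c) c := (hF c).continuousAt.div_const _
    apply this.eventually_mem
    rw [div_self hFc]
    exact isOpen_slitPlane.mem_nhds one_mem_slitPlane
  obtain ⟨r, hr, hball⟩ := Metric.eventually_nhds_iff_ball.1 hV
  have hL0 : DifferentiableOn ℂ (fun w => Complex.log (F w / F c)) (Metric.ball c r) := by
    intro w hw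
    exact (((hF w).div_const _).clog (hball w hw)).differentiableWithinAt
  set W := Metric.ball c r ∩ {z : ℂ | 1 < z.re} with hW
  have hWo : IsOpen W := Metric.isOpen_ball.inter hopen
  have hWc : IsPreconnected W :=
    ((convex_ball _ _).inter (convex_halfSpace_re_gt 1)).isPreconnected
  have hdW : DifferentiableOn ℂ (fun w => K w - Complex.log (F w / F c)) W :=
    (hK.differentiableOn.mono inter_subset_right).sub (hL0.mono inter_subset_left)
  obtain ⟨a, ha⟩ := hWo.exists_is_const_of_deriv_eq_zero hWc hdW (by
    intro w hw
    have h1 : DifferentiableAt ℂ K w := (hK w hw.2).differentiableAt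
    have h2 : HasDerivAt (fun w => Complex.log (F w / F c)) (deriv F w / F w) w := by
      have := ((hF w).hasDerivAt.div_const (F c)).clog (hball w hw.1)
      convert this using 1
      field_simp
    have h3 : deriv K w = deriv F w / F w := by
      have h4 : HasDerivAt F (exp (K w) * deriv K w) w := by
        refine h1.hasDerivAt.cexp.congr_of_eventuallyEq ?_
        filter_upwards [hopen.mem_nhds hw.2] with v hv
        exact (hKF v hv).symm
      rw [h4.deriv, hKF w hw.2, mul_div_cancel_left₀ _ (hF0 w hw.2.le)]
    have h5 := (h1.hasDerivAt.sub h2).deriv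
    rw [h3, sub_self] at h5
    exact h5)
  refine ⟨r, hr, fun w => Complex.log (F w / F c) + a, ?_, ?_⟩
  · exact (hL0.add_const a).analyticOnNhd Metric.isOpen_ball
  · intro w hw hw1
    rw [← ha w ⟨hw, hw1⟩]
    ring

lemma zeta_aux : ∃ F : ℂ → ℂ, Differentiable ℂ F ∧ (∀ z : ℂ, 1 ≤ z.re → F z ≠ 0) ∧
    ∀ z : ℂ, 1 < z.re → F z = (z - 1) * riemannZeta z := by
  classical
  let F := Function.update (fun s : ℂ ↦ (s - 1) * riemannZeta s) 1 1
  have hne : ∀ z, z ≠ 1 → F z = (z - 1) * riemannZeta z := fun z hz => by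
    simp [F, hz]
  have hd : ∀ z, z ≠ 1 → DifferentiableAt ℂ F z := by
    intro z hz
    have : DifferentiableAt ℂ (fun s : ℂ ↦ (s - 1) * riemannZeta s) z :=
      (differentiableAt_id.sub_const 1).mul (differentiableAt_riemannZeta hz)
    refine this.congr_of_eventuallyEq ?_
    filter_upwards [isOpen_ne.mem_nhds hz] with w hw using hne w hw
  refine ⟨F, ?_, ?_, ?_⟩
  · intro z
    by_cases hz : z = 1
    · subst hz
      refine (analyticAt_of_differentiable_on_punctured_nhds_of_continuousAt ?_ ?_).differentiableAt
      · filter_upwards [self_mem_nhdsWithin] with w hw using hd w hw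
      · simpa only [F, continuousAt_update_same] using riemannZeta_residue_one
    · exact hd z hz
  · intro z hz
    by_cases h : z = 1
    · simp [F, h]
    · rw [hne z h]
      exact mul_ne_zero (sub_ne_zero.2 h) (riemannZeta_ne_zero_of_one_le_re hz)
  · intro z hz
    apply hne
    rintro rfl
    simp at hz

lemma H_term_bound (p : Nat.Primes) (z : ℂ) (hz : 3 / 4 < z.re) :
    ‖((p : ℕ) : ℂ) ^ (-z)‖ < 1 ∧
    ‖-Complex.log (1 - ((p : ℕ) : ℂ) ^ (-z)) - ((p : ℕ) : ℂ) ^ (-z)‖ ≤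
      (1 - (2 : ℝ) ^ (-(3 / 4) : ℝ))⁻¹ / 2 * ((p : ℕ) : ℝ) ^ (-(3 / 2) : ℝ) := by
  have hp : 0 < (p : ℕ) := p.2.pos
  have hp2 : (2 : ℝ) ≤ ((p : ℕ) : ℝ) := by exact_mod_cast p.2.two_le
  set u := ((p : ℕ) : ℂ) ^ (-z) with hu
  have hn : ‖u‖ = ((p : ℕ) : ℝ) ^ (-z.re) := by
    rw [hu, Complex.norm_natCast_cpow_of_pos hp]; simp
  have h1 : ‖u‖ ≤ ((p : ℕ) : ℝ) ^ (-(3 / 4) : ℝ) := by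
    rw [hn]; exact Real.rpow_le_rpow_of_exponent_le (by linarith) (by linarith)
  have h2 : ((p : ℕ) : ℝ) ^ (-(3 / 4) : ℝ) ≤ (2 : ℝ) ^ (-(3 / 4) : ℝ) :=
    Real.rpow_le_rpow_of_nonpos (by norm_num) hp2 (by norm_num)
  have h3 : (2 : ℝ) ^ (-(3 / 4) : ℝ) < 1 :=
    Real.rpow_lt_one_of_one_lt_of_neg (by norm_num) (by norm_num)
  have hlt : ‖u‖ < 1 := by linarith
  refine ⟨hlt, ?_⟩
  have h4 := Complex.norm_log_one_add_sub_self_le (z := -u) (by simpa using hlt)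
  have h5 : ‖-Complex.log (1 - u) - u‖ = ‖Complex.log (1 + -u) - -u‖ := by
    rw [← norm_neg]; congr 1; rw [← sub_eq_add_neg]; ring
  rw [h5]
  refine h4.trans ?_
  rw [norm_neg]
  have h6 : ‖u‖ ^ 2 ≤ ((p : ℕ) : ℝ) ^ (-(3 / 2) : ℝ) := by
    calc ‖u‖ ^ 2 ≤ (((p : ℕ) : ℝ) ^ (-(3 / 4) : ℝ)) ^ 2 := by gcongr
      _ = ((p : ℕ) : ℝ) ^ (-(3 / 2) : ℝ) := by
        rw [← Real.rpow_natCast, ← Real.rpow_mul (by positivity)]; norm_num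
  have h7 : (1 - ‖u‖)⁻¹ ≤ (1 - (2 : ℝ) ^ (-(3 / 4) : ℝ))⁻¹ :=
    inv_anti₀ (by linarith) (by linarith)
  have h8 : 0 ≤ (1 - ‖u‖)⁻¹ := inv_nonneg.2 (by linarith)
  calc ‖u‖ ^ 2 * (1 - ‖u‖)⁻¹ / 2
      ≤ ((p : ℕ) : ℝ) ^ (-(3 / 2) : ℝ) * (1 - (2 : ℝ) ^ (-(3 / 4) : ℝ))⁻¹ / 2 := by gcongr
    _ = _ := by ring

lemma H_aux : ∃ H : ℂ → ℂ, DifferentiableOn ℂ H {z : ℂ | 3 / 4 < z.re} ∧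
    ∀ z : ℂ, 1 < z.re → H z = ∑' p : Nat.Primes, -Complex.log (1 - ((p : ℕ) : ℂ) ^ (-z)) -
      ∑' p : Nat.Primes, ((p : ℕ) : ℂ) ^ (-z) := by
  have hsum : Summable fun p : Nat.Primes =>
      (1 - (2 : ℝ) ^ (-(3 / 4) : ℝ))⁻¹ / 2 * ((p : ℕ) : ℝ) ^ (-(3 / 2) : ℝ) :=
    (Nat.Primes.summable_rpow.2 (by norm_num)).mul_left _
  refine ⟨fun z => ∑' p : Nat.Primes,
    (-Complex.log (1 - ((p : ℕ) : ℂ) ^ (-z)) - ((p : ℕ) : ℂ) ^ (-z)), ?_, ?_⟩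
  · refine differentiableOn_tsum_of_summable_norm hsum ?_
      (isOpen_lt continuous_const Complex.continuous_re) fun p z hz => (H_term_bound p z hz).2
    intro p z hz
    have hu : DifferentiableAt ℂ (fun z : ℂ => ((p : ℕ) : ℂ) ^ (-z)) z :=
      differentiableAt_id.neg.const_cpow (Or.inl (by exact_mod_cast p.2.ne_zero))
    have hs : 1 - ((p : ℕ) : ℂ) ^ (-z) ∈ slitPlane := by
      rw [sub_eq_add_neg]
      apply Complex.mem_slitPlane_of_norm_lt_one
      rw [norm_neg]
      exact (H_term_bound p z hz).1
    exact ((((differentiableAt_const 1).sub hu).clog hs).neg.sub hu).differentiableWithinAt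
  · intro z hz
    have h1 : Summable fun p : Nat.Primes => ((p : ℕ) : ℂ) ^ (-z) := by
      refine Summable.of_norm ?_
      refine (Nat.Primes.summable_rpow.2 (show -z.re < -1 by linarith)).congr fun p => ?_
      rw [Complex.norm_natCast_cpow_of_pos p.2.pos]; simp
    have h2 : Summable fun p : Nat.Primes => -Complex.log (1 - ((p : ℕ) : ℂ) ^ (-z)) :=
      h1.clog_one_sub.neg
    exact h2.tsum_sub h1

lemma LSeries_ind (T : Set ℕ) (hT : ∀ p ∈ T, p.Prime) (z : ℂ) :
    LSeries (T.indicator 1) z = ∑' p : T, ((p : ℕ) : ℂ) ^ (-z) := by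
  rw [tsum_subtype T (fun p : ℕ => (p : ℂ) ^ (-z)), LSeries]
  refine tsum_congr fun n => ?_
  by_cases hn : n ∈ T
  · simp [LSeries.term, hn, (hT n hn).ne_zero, Complex.cpow_neg]
  · simp [LSeries.term, hn]

lemma ind_bound (T : Set ℕ) (n : ℕ) : ‖(T.indicator 1 n : ℂ)‖ ≤ 1 := by
  by_cases hn : n ∈ T <;> simp [hn]

lemma LSeries_ind_analytic (T : Set ℕ) :
    AnalyticOnNhd ℂ (LSeries (T.indicator 1)) {z : ℂ | 1 < z.re} := by
  refine (LSeries_analyticOnNhd _).mono fun z hz => ?_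
  refine lt_of_le_of_lt (LSeries.abscissaOfAbsConv_le_of_le_const ⟨1, fun n _ => ind_bound T n⟩) ?_
  exact_mod_cast hz

/-- The prime zeta function. -/
lemma prime_aux : ∃ g : ℂ → ℂ, AnalyticOnNhd ℂ g {z : ℂ | 1 ≤ z.re} ∧
    ∀ z : ℂ, 1 < z.re →
      LSeries ({p : ℕ | p.Prime}.indicator 1) z = Complex.log (1 / (z - 1)) + g z := by
  obtain ⟨F, hF, hF0, hFz⟩ := zeta_aux
  obtain ⟨H, hH, hHz⟩ := H_aux
  have hHa : AnalyticOnNhd ℂ H {z : ℂ | 3 / 4 < z.re} :=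
    hH.analyticOnNhd (isOpen_lt continuous_const Complex.continuous_re)
  have hopen : IsOpen {z : ℂ | 1 < z.re} := isOpen_lt continuous_const Complex.continuous_re
  set P := LSeries ({p : ℕ | p.Prime}.indicator 1) with hP
  have hPz : ∀ z, P z = ∑' p : Nat.Primes, ((p : ℕ) : ℂ) ^ (-z) := fun z =>
    LSeries_ind _ (fun p hp => hp) z
  have hz1 : ∀ z : ℂ, 1 < z.re → z - 1 ≠ 0 := by
    intro z hz h
    rw [sub_eq_zero] at h
    rw [h] at hz
    simp at hz
  have hlog : DifferentiableOn ℂ (fun z : ℂ => Complex.log (1 / (z - 1))) {z : ℂ | 1 < z.re} := by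
    intro z hz
    refine (DifferentiableAt.clog ?_ ?_).differentiableWithinAt
    · exact (differentiableAt_const 1).div (differentiableAt_id.sub_const 1) (hz1 z hz)
    · left
      rw [one_div, Complex.inv_re]
      have : 0 < Complex.normSq (z - 1) := Complex.normSq_pos.2 (hz1 z hz)
      have h2 : 0 < (z - 1).re := by
        have : 1 < z.re := hz
        simp; linarith
      positivity
  obtain ⟨g, hg, hgK⟩ := log_ext_aux (fun z => H z + P z - Complex.log (1 / (z - 1))) F
    (((hHa.mono fun z (hz : 1 < z.re) => show 3 / 4 < z.re by linarith).add
      (LSeries_ind_analytic _)).sub (hlog.analyticOnNhd hopen)) hF hF0 (by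
      intro z hz
      have : H z + P z = ∑' p : Nat.Primes, -Complex.log (1 - ((p : ℕ) : ℂ) ^ (-z)) := by
        rw [hHz z hz, hPz]; ring
      rw [this, Complex.exp_sub, riemannZeta_eulerProduct_exp_log hz, hFz z hz,
        Complex.exp_log (one_div_ne_zero (hz1 z hz))]
      have := hz1 z hz
      field_simp)
  refine ⟨fun z => g z - H z, ?_, ?_⟩
  · exact hg.sub (hHa.mono fun z (hz : 1 ≤ z.re) => show 3 / 4 < z.re by linarith)
  · intro z hz
    simp only [hgK z hz]
    ring

lemma sum_ind (T : Set ℕ) (hT : ∀ p ∈ T, p.Prime) (t : ℝ) (ht : 0 ≤ t) :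
    ∑ k ∈ Finset.Icc 1 ⌊t⌋₊, (T.indicator 1 k : ℂ) =
      (({p : ℕ | p ∈ T ∧ (p : ℝ) ≤ t}.ncard : ℝ) : ℂ) := by
  classical
  have : {p : ℕ | p ∈ T ∧ (p : ℝ) ≤ t} = ↑((Finset.Icc 1 ⌊t⌋₊).filter (· ∈ T)) := by
    ext p
    simp only [mem_ofPred_eq, Finset.coe_filter, Finset.mem_Icc, Nat.le_floor_iff ht]
    constructor
    · rintro ⟨h1, h2⟩; exact ⟨⟨(hT p h1).one_le, h2⟩, h1⟩
    · rintro ⟨⟨_, h2⟩, h1⟩; exact ⟨h1, h2⟩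
  rw [this, Set.ncard_coe_finset]
  simp [Set.indicator_apply, Finset.sum_boole]

/-- Analytic continuation of a Dirichlet series with small partial sums. -/
lemma mellin_aux (f : ℕ → ℂ) (hf1 : f 1 = 0) (B : ℝ) (hB : ∀ n, ‖f n‖ ≤ B) (α : ℝ) (hα : 0 < α)
    (hO : (fun t : ℝ => ∑ k ∈ Finset.Icc 1 ⌊t⌋₊, f k) =O[atTop] fun t : ℝ => t ^ (-(α - 1))) :
    ∃ g : ℂ → ℂ, AnalyticOnNhd ℂ g {z : ℂ | 1 ≤ z.re} ∧
      ∀ z : ℂ, 1 < z.re → LSeries f z = g z := by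
  set A : ℝ → ℂ := fun t => ∑ k ∈ Finset.Icc 1 ⌊t⌋₊, f k with hA
  have hA0 : ∀ t : ℝ, t ≤ 1 → A t = 0 := by
    intro t ht
    refine Finset.sum_eq_zero fun k hk => ?_
    rw [Finset.mem_Icc] at hk
    have : ⌊t⌋₊ ≤ 1 := by simpa using Nat.floor_le_floor ht
    have : k = 1 := by omega
    rw [this, hf1]
  have hloc : MeasureTheory.LocallyIntegrableOn A (Ioi 0) := by
    have := locallyIntegrableOn_mul_sum_Icc f (m := 1) (le_refl (0 : ℝ)) (g := fun _ => (1 : ℂ))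
      (MeasureTheory.locallyIntegrableOn_const _)
    simp only [one_mul] at this
    exact this.mono_set Ioi_subset_Ici_self
  have hmel : ∀ s : ℂ, s.re < α - 1 → DifferentiableAt ℂ (mellin A) s := by
    intro s hs
    refine mellin_differentiableAt_of_isBigO_rpow (a := α - 1) (b := s.re - 1) hloc hO hs ?_
      (by linarith)
    refine Asymptotics.IsBigO.of_bound 1 ?_
    filter_upwards [mem_nhdsWithin_of_mem_nhds (Iio_mem_nhds (zero_lt_one' ℝ))] with t ht
    rw [hA0 t (le_of_lt ht)]
    simp
  refine ⟨fun z => z * mellin A (-z), ?_, ?_⟩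
  · have : DifferentiableOn ℂ (fun z => z * mellin A (-z)) {z : ℂ | 1 - α < z.re} := by
      intro z hz
      have hz' : 1 - α < z.re := hz
      have h1 : DifferentiableAt ℂ (mellin A) (-z) := hmel _ (by simp; linarith)
      exact (differentiableAt_id.mul
        (h1.comp z (differentiableAt_id.neg))).differentiableWithinAt
    exact (this.analyticOnNhd (isOpen_lt continuous_const Complex.continuous_re)).mono
      fun z (hz : 1 ≤ z.re) => show 1 - α < z.re by linarith
  · intro z hz
    rw [LSeries_eq_mul_integral' f zero_le_one hz]
    · congr 1
      rw [mellin]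
      symm
      rw [← MeasureTheory.setIntegral_eq_of_subset_of_forall_sdiff_eq_zero measurableSet_Ioi
        (Ioi_subset_Ioi (zero_le_one' ℝ))]
      · refine MeasureTheory.setIntegral_congr_fun measurableSet_Ioi fun t ht => ?_
        simp only [smul_eq_mul]
        rw [mul_comm, neg_add']
      · intro t ht
        have : A t = 0 := hA0 t (by simpa using ht.2)
        simp only [hA] at this
        rw [this, zero_mul]
    · refine Asymptotics.IsBigO.of_bound B ?_
      filter_upwards with n
      rw [Real.rpow_one, Real.norm_of_nonneg (Finset.sum_nonneg fun _ _ => norm_nonneg _)]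
      calc ∑ k ∈ Finset.Icc 1 n, ‖f k‖ ≤ ∑ k ∈ Finset.Icc 1 n, B :=
            Finset.sum_le_sum fun k _ => hB k
        _ = B * ‖(n : ℝ)‖ := by simp [mul_comm]

/-- A set of primes with natural density `d` and an error term `|π_S(x)/π(x) - d| ≤ C x^{-α}`
is a regular set of primes. -/
theorem natural_density_with_error_term_regular
    (S : Set ℕ) (hS : ∀ p ∈ S, p.Prime) (d : ℝ)
    (hnat : Tendsto
      (fun x : ℝ => (({p : ℕ | p ∈ S ∧ (p : ℝ) ≤ x}.ncard : ℝ)) /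
        ({p : ℕ | p.Prime ∧ (p : ℝ) ≤ x}.ncard : ℝ)) atTop (𝓝 d))
    (α C M : ℝ) (hα : 0 < α) (hC : 0 < C) (hM : 0 < M)
    (herr : ∀ x : ℝ, M < x →
      |(({p : ℕ | p ∈ S ∧ (p : ℝ) ≤ x}.ncard : ℝ)) /
        ({p : ℕ | p.Prime ∧ (p : ℝ) ≤ x}.ncard : ℝ) - d| ≤ C * x ^ (-α)) :
    ∃ g : ℂ → ℂ, AnalyticOnNhd ℂ g {z : ℂ | 1 ≤ z.re} ∧
      ∀ z : ℂ, 1 < z.re →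
        ∑' p : S, ((p : ℕ) : ℂ) ^ (-z) = (d : ℂ) * Complex.log (1 / (z - 1)) + g z := by
  set Pr : Set ℕ := {p : ℕ | p.Prime} with hPr
  obtain ⟨g1, hg1, hg1z⟩ := prime_aux
  have hPr1 : (1 : ℕ) ∉ Pr := Nat.not_prime_one
  have hS1 : (1 : ℕ) ∉ S := fun h => Nat.not_prime_one (hS 1 h)
  obtain ⟨g2, hg2, hg2z⟩ := mellin_aux (S.indicator 1 - (d : ℂ) • Pr.indicator 1)
    (by simp [hPr1, hS1]) (1 + |d|) (by
      intro n
      simp only [Pi.sub_apply, Pi.smul_apply, smul_eq_mul]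
      refine (norm_sub_le _ _).trans (add_le_add (ind_bound S n) ?_)
      rw [norm_mul, Complex.norm_real, Real.norm_eq_abs]
      exact mul_le_of_le_one_right (abs_nonneg _) (ind_bound Pr n)) α hα (by
      refine Asymptotics.IsBigO.of_bound C ?_
      filter_upwards [eventually_gt_atTop M, eventually_ge_atTop 2] with t htM ht2
      have ht0 : 0 < t := by linarith
      have hsum : ∑ k ∈ Finset.Icc 1 ⌊t⌋₊, (S.indicator 1 - (d : ℂ) • Pr.indicator 1 : ℕ → ℂ) k =
          (((({p : ℕ | p ∈ S ∧ (p : ℝ) ≤ t}.ncard : ℝ)) -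
            d * ({p : ℕ | p.Prime ∧ (p : ℝ) ≤ t}.ncard : ℝ) : ℝ) : ℂ) := by
        simp only [Pi.sub_apply, Pi.smul_apply, smul_eq_mul, Finset.sum_sub_distrib,
          ← Finset.mul_sum]
        rw [sum_ind S hS t ht0.le, sum_ind Pr (fun p hp => hp) t ht0.le]
        push_cast
        rfl
      have hsub : {p : ℕ | p.Prime ∧ (p : ℝ) ≤ t} ⊆ ↑(Finset.Icc 1 ⌊t⌋₊) := by
        intro p hp
        simp only [Finset.coe_Icc, Set.mem_Icc]
        exact ⟨hp.1.one_le, Nat.le_floor hp.2⟩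
      have hle : ({p : ℕ | p.Prime ∧ (p : ℝ) ≤ t}.ncard : ℝ) ≤ t := by
        have h1 := Set.ncard_le_ncard hsub (Finset.finite_toSet _)
        rw [Set.ncard_coe_finset, Nat.card_Icc, Nat.add_sub_cancel] at h1
        exact (Nat.cast_le.2 h1).trans (Nat.floor_le ht0.le)
      have hpos : 0 < ({p : ℕ | p.Prime ∧ (p : ℝ) ≤ t}.ncard : ℝ) := by
        rw [Nat.cast_pos, Set.ncard_pos ((Finset.finite_toSet _).subset hsub)]
        exact ⟨2, Nat.prime_two, by exact_mod_cast ht2⟩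
      have he := herr t htM
      rw [hsum, Complex.norm_real, Real.norm_eq_abs, Real.norm_of_nonneg (by positivity)]
      generalize ({p : ℕ | p.Prime ∧ (p : ℝ) ≤ t}.ncard : ℝ) = b at *
      generalize ({p : ℕ | p ∈ S ∧ (p : ℝ) ≤ t}.ncard : ℝ) = a at *
      have e1 : a - d * b = b * (a / b - d) := by field_simp
      rw [e1, abs_mul, abs_of_pos hpos]
      calc b * |a / b - d| ≤ t * (C * t ^ (-α)) := by gcongr
        _ = C * t ^ (-(α - 1)) := by
          rw [show -(α - 1) = 1 + -α by ring, Real.rpow_add ht0, Real.rpow_one]; ring)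
  refine ⟨fun z => d * g1 z + g2 z, ?_, ?_⟩
  · exact (analyticOnNhd_const.mul hg1).add hg2
  · intro z hz
    have h1 := hg2z z hz
    have hsS : LSeriesSummable (S.indicator 1) z :=
      LSeriesSummable_of_bounded_of_one_lt_re (m := 1) (fun n _ => ind_bound S n) hz
    have hsP : LSeriesSummable (Pr.indicator 1) z :=
      LSeriesSummable_of_bounded_of_one_lt_re (m := 1) (fun n _ => ind_bound Pr n) hz
    rw [LSeries_sub hsS (hsP.smul _), LSeries_smul, LSeries_ind S hS, hg1z z hz] at h1
    linear_combination h1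
end

section
/- (Delange) Let g: ℕ → ℂ be a multiplicative arithmetic function with |g(n)| ≤ 1 for all n, and suppose there exists a ∈ ℂ with a ≠ 1 such that lim_{x→∞} (∑_{p ≤ x, p prime} g(p))/π(x) = a. Then lim_{x→∞} (∑_{n ≤ x} g(n))/x = 0. -/
open Filter Topology Finset

section

namespace DelangeAux

open MeasureTheory

/-- normalised Chebyshev function -/
noncomputable def B (u : ℝ) : ℝ := Chebyshev.psi (Real.exp u) * Real.exp (-u)

noncomputable def CB : ℝ := Real.log 4 + 4

lemma CB_pos : 0 < CB := by
  have : 0 < Real.log 4 := Real.log_pos (by norm_num)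
  unfold CB; linarith

lemma B_nonneg (u : ℝ) : 0 ≤ B u :=
  mul_nonneg (Chebyshev.psi_nonneg _) (Real.exp_pos _).le

lemma B_le (u : ℝ) : B u ≤ CB := by
  have h := Chebyshev.psi_le_const_mul_self (Real.exp_pos u).le
  unfold B CB
  calc _ ≤ ((Real.log 4 + 4) * Real.exp u) * Real.exp (-u) := by gcongr
    _ = _ := by rw [mul_assoc, ← Real.exp_add]; simp

lemma B_zero {u : ℝ} (hu : u ≤ 0) : B u = 0 := by
  unfold B
  rw [Chebyshev.psi_eq_zero_of_le_one (Real.exp_le_one_iff.mpr hu), zero_mul]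

lemma B_slow {u v : ℝ} (h : u ≤ v) : B u * Real.exp (u - v) ≤ B v := by
  unfold B
  rw [mul_assoc, ← Real.exp_add, show -u + (u - v) = -v by ring]
  gcongr

lemma B_meas : Measurable B := by
  unfold B
  exact (Chebyshev.psi_mono.measurable.comp Real.measurable_exp).mul
    (Real.measurable_exp.comp measurable_neg)

lemma Bs_bound (u : ℝ) : ‖(B u : ℂ) - 1‖ ≤ CB + 1 := by
  have h1 := B_nonneg u
  have h2 := B_le u
  calc ‖(B u : ℂ) - 1‖ ≤ ‖(B u : ℂ)‖ + ‖(1:ℂ)‖ := norm_sub_le _ _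
    _ ≤ _ := by
      rw [Complex.norm_real, Real.norm_of_nonneg h1, norm_one]; linarith

/-- The continuous extension of the Laplace transform. -/
noncomputable def G (s : ℂ) : ℂ :=
  (ArithmeticFunction.vonMangoldt.LFunctionResidueClassAux (q := 1) 1 s - 1) / s

lemma G_cont : ContinuousOn G {s : ℂ | 1 ≤ s.re} := by
  unfold G
  refine ContinuousOn.div ?_ continuousOn_id ?_
  · exact (ArithmeticFunction.vonMangoldt.continuousOn_LFunctionResidueClassAux _).sub
      continuousOn_const
  · intro s hs h0
    simp only [Set.mem_ofPred_eq] at *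
    rw [h0] at hs; simp at hs; linarith

lemma resid (n : ℕ) : ArithmeticFunction.vonMangoldt.residueClass (q := 1) 1 n =
    ArithmeticFunction.vonMangoldt n := by
  unfold ArithmeticFunction.vonMangoldt.residueClass
  rw [Set.indicator_of_mem]
  exact Subsingleton.elim _ _

lemma psi_sum (t : ℝ) : ∑ k ∈ Icc 1 ⌊t⌋₊, ((ArithmeticFunction.vonMangoldt k : ℝ) : ℂ) =
    (Chebyshev.psi t : ℂ) := by
  unfold Chebyshev.psi
  push_cast
  rfl

lemma L_eq {s : ℂ} (hs : 1 < s.re) :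
    LSeries (fun n => ((ArithmeticFunction.vonMangoldt n : ℝ) : ℂ)) s
      = s * ∫ t in Set.Ioi (1 : ℝ), (Chebyshev.psi t : ℂ) * t ^ (-(s + 1)) := by
  have := LSeries_eq_mul_integral_of_nonneg (fun n => ArithmeticFunction.vonMangoldt n)
    zero_le_one hs ?_ (fun n => ArithmeticFunction.vonMangoldt_nonneg)
  · rw [this]
    simp only [psi_sum]
  · refine Asymptotics.IsBigO.of_bound CB (Eventually.of_forall fun n => ?_)
    have h := Chebyshev.psi_le_const_mul_self (x := n) n.cast_nonneg
    have h0 := Chebyshev.psi_nonneg (n : ℝ)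
    have e : ∑ k ∈ Icc 1 n, ArithmeticFunction.vonMangoldt k = Chebyshev.psi n := by
      unfold Chebyshev.psi; rw [Nat.floor_natCast]; rfl
    rw [e, Real.norm_of_nonneg h0, Real.rpow_one, Real.norm_of_nonneg n.cast_nonneg]
    exact h

lemma exp_image : Real.exp '' Set.Ioi 0 = Set.Ioi 1 := by
  ext x; constructor
  · rintro ⟨u, hu, rfl⟩; exact Real.one_lt_exp_iff.mpr hu
  · intro hx
    exact ⟨Real.log x, Real.log_pos hx, Real.exp_log (lt_trans zero_lt_one hx)⟩

lemma L_eq2 {s : ℂ} (hs : 1 < s.re) :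
    LSeries (fun n => ((ArithmeticFunction.vonMangoldt n : ℝ) : ℂ)) s
      = s * ∫ u in Set.Ioi (0 : ℝ), (B u : ℂ) * Complex.exp (-((s - 1) * u)) := by
  rw [L_eq hs, ← exp_image, integral_image_eq_integral_abs_deriv_smul measurableSet_Ioi
    (fun x _ => (Real.hasDerivAt_exp x).hasDerivWithinAt) Real.exp_injective.injOn]
  congr 1
  refine setIntegral_congr_fun measurableSet_Ioi fun u _ => ?_
  simp only [B]
  rw [abs_of_pos (Real.exp_pos u), Complex.real_smul, Complex.cpow_def_of_ne_zero
    (by exact_mod_cast (Real.exp_pos u).ne'), ← Complex.ofReal_log (Real.exp_pos u).le,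
    Real.log_exp]
  push_cast
  rw [mul_left_comm, mul_assoc, ← Complex.exp_add, ← Complex.exp_add]
  ring_nf

lemma exp_integrable {z : ℂ} (hz : 0 < z.re) :
    IntegrableOn (fun u : ℝ => Complex.exp (-(z * u))) (Set.Ioi 0) := by
  have := integrableOn_exp_mul_complex_Ioi (a := -z) (by simpa using hz) 0
  simpa using this

lemma Bs_integrable {z : ℂ} (hz : 0 < z.re) :
    IntegrableOn (fun u : ℝ => ((B u : ℂ) - 1) * Complex.exp (-(z * u))) (Set.Ioi 0) := by
  refine Integrable.bdd_mul (exp_integrable hz) (c := CB + 1) ?_ (ae_of_all _ Bs_bound)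
  exact ((Complex.measurable_ofReal.comp B_meas).sub_const 1).aestronglyMeasurable

lemma B_integrable {z : ℂ} (hz : 0 < z.re) :
    IntegrableOn (fun u : ℝ => (B u : ℂ) * Complex.exp (-(z * u))) (Set.Ioi 0) := by
  refine ((Bs_integrable hz).add (exp_integrable hz)).congr (ae_of_all _ fun u => ?_)
  simp only [Pi.add_apply]; ring

lemma G_eq {z : ℂ} (hz : 0 < z.re) :
    ∫ u in Set.Ioi (0 : ℝ), ((B u : ℂ) - 1) * Complex.exp (-(z * u)) = G (1 + z) := by
  have hs : 1 < (1 + z).re := by simpa using hz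
  have hz0 : z ≠ 0 := by rintro rfl; simp at hz
  have hs0 : 1 + z ≠ 0 := by intro h; rw [h] at hs; simp at hs; linarith
  have e1 := L_eq2 hs
  rw [add_sub_cancel_left] at e1
  have e2 : ∫ u in Set.Ioi (0 : ℝ), Complex.exp (-(z * u)) = 1 / z := by
    have := integral_exp_mul_complex_Ioi (a := -z) (by simpa using hz) 0
    simp only [neg_mul] at this
    rw [this]; simp
  have e3 := ArithmeticFunction.vonMangoldt.eqOn_LFunctionResidueClassAux (q := 1) (a := 1)
    isUnit_one (Set.mem_ofPred.mpr hs)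
  simp only [resid] at e3
  unfold G
  rw [e3, e1]
  simp only [sub_mul, one_mul]
  rw [integral_sub (B_integrable hz) (exp_integrable hz), e2]
  simp
  field_simp
  ring

end DelangeAux
end

section

namespace DelangeAux
open MeasureTheory

/-- Fejer kernel -/
noncomputable def K (y : ℝ) : ℝ := ∫ τ in (-1 : ℝ)..1, (1 - |τ|) * Real.cos (τ * y)

lemma K_cont : Continuous K := by
  unfold K
  apply intervalIntegral.continuous_parametric_intervalIntegral_of_continuous'
  fun_prop

lemma K_zero : K 0 = 1 := by
  unfold K
  simp only [mul_zero, Real.cos_zero, mul_one]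
  rw [← intervalIntegral.integral_add_adjacent_intervals (b := 0)
    (by apply Continuous.intervalIntegrable; fun_prop)
    (by apply Continuous.intervalIntegrable; fun_prop)]
  have h1 : ∫ τ in (-1 : ℝ)..0, (1 - |τ|) = ∫ τ in (-1 : ℝ)..0, (1 + τ) := by
    apply intervalIntegral.integral_congr
    intro τ hτ
    rw [Set.uIcc_of_le (by norm_num)] at hτ
    simp only
    rw [abs_of_nonpos hτ.2]; ring
  have h2 : ∫ τ in (0 : ℝ)..1, (1 - |τ|) = ∫ τ in (0 : ℝ)..1, (1 - τ) := by
    apply intervalIntegral.integral_congr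
    intro τ hτ
    rw [Set.uIcc_of_le (by norm_num)] at hτ
    simp only
    rw [abs_of_nonneg hτ.1]
  rw [h1, h2, intervalIntegral.integral_add (by simp) (by simp),
    intervalIntegral.integral_sub (by simp) (by simp)]
  simp; norm_num

lemma K_eq {y : ℝ} (hy : y ≠ 0) : K y = 2 * (1 - Real.cos y) / y ^ 2 := by
  unfold K
  rw [← intervalIntegral.integral_add_adjacent_intervals (b := 0)
    (by apply Continuous.intervalIntegrable; fun_prop)
    (by apply Continuous.intervalIntegrable; fun_prop)]
  have h1 : ∫ τ in (-1 : ℝ)..0, (1 - |τ|) * Real.cos (τ * y)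
      = ∫ τ in (-1 : ℝ)..0, (1 + τ) * Real.cos (τ * y) := by
    apply intervalIntegral.integral_congr
    intro τ hτ
    rw [Set.uIcc_of_le (by norm_num)] at hτ
    simp only
    rw [abs_of_nonpos hτ.2]; ring
  have h2 : ∫ τ in (0 : ℝ)..1, (1 - |τ|) * Real.cos (τ * y)
      = ∫ τ in (0 : ℝ)..1, (1 - τ) * Real.cos (τ * y) := by
    apply intervalIntegral.integral_congr
    intro τ hτ
    rw [Set.uIcc_of_le (by norm_num)] at hτ
    simp only
    rw [abs_of_nonneg hτ.1]
  have d1 : ∀ τ : ℝ, HasDerivAt (fun τ => Real.sin (τ * y)) (y * Real.cos (τ * y)) τ := by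
    intro τ
    have := ((hasDerivAt_id' τ).mul_const y).sin
    simpa [mul_comm] using this
  have d2 : ∀ τ : ℝ, HasDerivAt (fun τ => Real.cos (τ * y)) (-(y * Real.sin (τ * y))) τ := by
    intro τ
    have := ((hasDerivAt_id' τ).mul_const y).cos
    simpa [mul_comm] using this
  have i1 := intervalIntegral.integral_eq_sub_of_hasDerivAt (a := -1) (b := 0)
    (f := fun τ => (1 + τ) * (Real.sin (τ * y) / y) + Real.cos (τ * y) / y ^ 2)
    (f' := fun τ => (1 + τ) * Real.cos (τ * y))
    (fun τ _ => by
      have := ((((hasDerivAt_id τ).const_add 1).mul ((d1 τ).div_const y)).add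
        ((d2 τ).div_const (y ^ 2)))
      refine HasDerivAt.congr_deriv this ?_
      simp only [id]; field_simp; ring)
    (by apply Continuous.intervalIntegrable; fun_prop)
  have i2 := intervalIntegral.integral_eq_sub_of_hasDerivAt (a := 0) (b := 1)
    (f := fun τ => (1 - τ) * (Real.sin (τ * y) / y) - Real.cos (τ * y) / y ^ 2)
    (f' := fun τ => (1 - τ) * Real.cos (τ * y))
    (fun τ _ => by
      have := ((((hasDerivAt_id τ).const_sub 1).mul ((d1 τ).div_const y)).sub
        ((d2 τ).div_const (y ^ 2)))
      refine HasDerivAt.congr_deriv this ?_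
      simp only [id]; field_simp; ring)
    (by apply Continuous.intervalIntegrable; fun_prop)
  rw [h1, h2, i1, i2]
  simp
  ring

lemma K_nonneg (y : ℝ) : 0 ≤ K y := by
  by_cases hy : y = 0
  · rw [hy, K_zero]; norm_num
  · rw [K_eq hy]
    have := Real.cos_le_one y
    have : 0 ≤ 1 - Real.cos y := by linarith
    positivity

lemma K_le_two (y : ℝ) : K y ≤ 2 := by
  have h : ‖K y‖ ≤ 1 * |(1:ℝ) - (-1)| := by
    unfold K
    apply intervalIntegral.norm_integral_le_of_norm_le_const
    intro τ hτ
    rw [Set.uIoc_of_le (by norm_num)] at hτ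
    have h1 : |τ| ≤ 1 := abs_le.mpr ⟨hτ.1.le, hτ.2⟩
    have h2 := Real.abs_cos_le_one (τ * y)
    rw [norm_mul, Real.norm_eq_abs, Real.norm_eq_abs, abs_of_nonneg (by linarith)]
    have := abs_nonneg τ
    nlinarith [abs_nonneg (Real.cos (τ * y))]
  have := le_abs_self (K y)
  rw [Real.norm_eq_abs] at h
  norm_num at h
  linarith

lemma K_le (y : ℝ) : K y ≤ 6 * (1 + y ^ 2)⁻¹ := by
  have h1 := K_le_two y
  have h2 : K y * y ^ 2 ≤ 4 := by
    by_cases hy : y = 0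
    · rw [hy]; norm_num
    · rw [K_eq hy, div_mul_cancel₀ _ (by positivity)]
      have := Real.neg_one_le_cos y
      linarith
  rw [← div_eq_mul_inv, le_div_iff₀ (by positivity)]
  linarith

lemma K_int : Integrable K := by
  refine Integrable.mono' (integrable_inv_one_add_sq.const_mul 6)
    K_cont.aestronglyMeasurable (ae_of_all _ fun y => ?_)
  rw [Real.norm_of_nonneg (K_nonneg y)]
  exact K_le y

lemma K_pos : 0 < ∫ y, K y := by
  rw [integral_pos_iff_support_of_nonneg K_nonneg K_int]
  apply IsOpen.measure_pos
  · exact K_cont.isOpen_support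
  · exact ⟨0, by simp [K_zero]⟩

lemma K_cplx (y : ℝ) :
    ∫ τ in (-1 : ℝ)..1, ((1 - |τ| : ℝ) : ℂ) * Complex.exp (Complex.I * (τ * y)) = (K y : ℂ) := by
  have h0 : ∫ τ in (-1 : ℝ)..1, (1 - |τ|) * Real.sin (τ * y) = 0 := by
    have := intervalIntegral.integral_comp_neg (a := -1) (b := 1)
      (fun τ => (1 - |τ|) * Real.sin (τ * y))
    simp only [abs_neg, neg_mul, Real.sin_neg, mul_neg, neg_neg,
      intervalIntegral.integral_neg] at this
    linarith
  have e : ∀ τ : ℝ, ((1 - |τ| : ℝ) : ℂ) * Complex.exp (Complex.I * (τ * y))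
     = (((1 - |τ|) * Real.cos (τ * y) : ℝ) : ℂ)
        + Complex.I * (((1 - |τ|) * Real.sin (τ * y) : ℝ) : ℂ) := by
    intro τ
    rw [mul_comm Complex.I, Complex.exp_mul_I]
    push_cast
    ring
  simp only [e]
  rw [intervalIntegral.integral_add
    (by apply Continuous.intervalIntegrable; fun_prop)
    (by apply Continuous.intervalIntegrable; fun_prop),
    intervalIntegral.integral_const_mul, intervalIntegral.integral_ofReal,
    intervalIntegral.integral_ofReal, h0]
  simp [K]

end DelangeAux
end

section

namespace DelangeAux
open MeasureTheory

lemma W1 (l y : ℝ) {σ : ℝ} (hσ : 0 < σ) :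
    ∫ u in Set.Ioi (0:ℝ), ((B u : ℂ) - 1) * Complex.exp (-((σ : ℂ) * u)) * (K (l * (y - u)) : ℂ)
    = ∫ τ in (-1 : ℝ)..1, ((1 - |τ| : ℝ) : ℂ) * Complex.exp (Complex.I * (τ * (l * y)))
        * G (1 + (σ + Complex.I * (l * τ))) := by
  have hz : ∀ τ : ℝ, 0 < ((σ : ℂ) + Complex.I * (l * τ)).re := by
    intro τ; simpa using hσ
  have e1 : ∀ u : ℝ, ((B u : ℂ) - 1) * Complex.exp (-((σ : ℂ) * u)) * (K (l * (y - u)) : ℂ)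
     = ∫ τ in Set.Ioc (-1 : ℝ) 1, (((B u : ℂ) - 1) * Complex.exp (-((σ : ℂ) * u))) *
        (((1 - |τ| : ℝ) : ℂ) * Complex.exp (Complex.I * (τ * ((l * (y - u) : ℝ) : ℂ)))) := by
    intro u
    rw [← K_cplx, intervalIntegral.integral_of_le (by norm_num), integral_const_mul]
  simp only [e1]
  rw [integral_integral_swap]
  · rw [intervalIntegral.integral_of_le (by norm_num)]
    refine integral_congr_ae (ae_of_all _ fun τ => ?_)
    simp only
    rw [← G_eq (hz τ), ← integral_const_mul]
    refine integral_congr_ae (ae_of_all _ fun u => ?_)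
    simp only
    have : Complex.exp (-((σ:ℂ) * u)) * Complex.exp (Complex.I * (τ * ((l * (y - u) : ℝ) : ℂ)))
      = Complex.exp (Complex.I * (τ * (l * y))) *
        Complex.exp (-((σ + Complex.I * (l * τ)) * u)) := by
      rw [← Complex.exp_add, ← Complex.exp_add]; congr 1; push_cast; ring
    linear_combination (((B u : ℂ) - 1) * ((1 - |τ| : ℝ) : ℂ)) * this
  · have hB := Bs_integrable (z := (σ : ℂ)) (by simpa using hσ)
    have h1 : Integrable (fun τ : ℝ => (1:ℂ)) (volume.restrict (Set.Ioc (-1:ℝ) 1)) :=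
      integrable_const 1
    have hP := Integrable.mul_prod hB h1
    refine (hP.mul_bdd (c := 1) (g := fun p : ℝ × ℝ => ((1 - |p.2| : ℝ) : ℂ) * Complex.exp (Complex.I * (p.2 * ((l * (y - p.1) : ℝ) : ℂ)))) ?_ ?_).congr ?_
    · apply Continuous.aestronglyMeasurable; fun_prop
    · have : ∀ᵐ p ∂((volume.restrict (Set.Ioi (0:ℝ))).prod (volume.restrict (Set.Ioc (-1:ℝ) 1))),
          p ∈ Set.Ioi (0:ℝ) ×ˢ Set.Ioc (-1:ℝ) 1 := by
        rw [Measure.prod_restrict]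
        exact ae_restrict_mem (measurableSet_Ioi.prod measurableSet_Ioc)
      filter_upwards [this] with p hp
      have hp2 := hp.2
      have h1 : |p.2| ≤ 1 := abs_le.mpr ⟨hp2.1.le, hp2.2⟩
      have := abs_nonneg p.2
      rw [norm_mul, show Complex.I * ((p.2 : ℂ) * ((l * (y - p.1) : ℝ) : ℂ)) = ((p.2 * (l * (y - p.1)) : ℝ) : ℂ) * Complex.I by push_cast; ring, Complex.norm_exp_ofReal_mul_I, Complex.norm_real, Real.norm_eq_abs,
        abs_of_nonneg (by linarith)]
      linarith
    · refine ae_of_all _ fun p => ?_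
      simp only [Function.uncurry, mul_one]

lemma Kl_int {l : ℝ} (hl : 0 < l) (y : ℝ) : Integrable (fun u => K (l * (y - u))) := by
  have h := (K_int.comp_mul_left' hl.ne')
  exact h.comp_sub_left y

lemma W2 {l : ℝ} (hl : 0 < l) (y : ℝ) :
    ∫ u in Set.Ioi (0:ℝ), ((B u : ℂ) - 1) * (K (l * (y - u)) : ℂ)
    = ∫ τ in (-1 : ℝ)..1, ((1 - |τ| : ℝ) : ℂ) * Complex.exp (Complex.I * (τ * (l * y)))
        * G (1 + (Complex.I * (l * τ))) := by
  have hKc : Continuous (fun u => K (l * (y - u))) := K_cont.comp (by fun_prop)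
  have lim1 : Tendsto (fun σ : ℝ => ∫ u in Set.Ioi (0:ℝ), ((B u : ℂ) - 1) * Complex.exp (-((σ : ℂ) * u)) * (K (l * (y - u)) : ℂ)) (𝓝[>] 0) (𝓝 (∫ u in Set.Ioi (0:ℝ), ((B u : ℂ) - 1) * (K (l * (y - u)) : ℂ))) := by
    refine tendsto_integral_filter_of_dominated_convergence (fun u => (CB + 1) * K (l * (y - u)))
      ?_ ?_ ?_ ?_
    · refine Eventually.of_forall fun σ => ?_
      refine AEStronglyMeasurable.mul (AEStronglyMeasurable.mul ?_ ?_) ?_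
      · exact ((Complex.measurable_ofReal.comp B_meas).sub_const 1).aestronglyMeasurable
      · apply Continuous.aestronglyMeasurable; fun_prop
      · exact (Complex.continuous_ofReal.comp hKc).aestronglyMeasurable
    · filter_upwards [self_mem_nhdsWithin] with σ hσ
      filter_upwards [ae_restrict_mem measurableSet_Ioi] with u hu
      have hσ' : 0 < σ := hσ
      have hu' : 0 < u := hu
      rw [norm_mul, norm_mul, Complex.norm_real, Real.norm_of_nonneg (K_nonneg _)]
      refine mul_le_mul_of_nonneg_right ?_ (K_nonneg _)
      have : ‖Complex.exp (-((σ : ℂ) * u))‖ ≤ 1 := by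
        rw [Complex.norm_exp]
        simp
        positivity
      have h2 := Bs_bound u
      calc _ ≤ (CB + 1) * 1 := by gcongr; exact (norm_nonneg _).trans h2
        _ = _ := mul_one _
    · exact ((Kl_int hl y).const_mul _).integrableOn
    · refine ae_of_all _ fun u => ?_
      have : Tendsto (fun σ : ℝ => ((B u : ℂ) - 1) * Complex.exp (-((σ : ℂ) * u)) * (K (l * (y - u)) : ℂ)) (𝓝 0) (𝓝 (((B u : ℂ) - 1) * Complex.exp (-(((0:ℝ) : ℂ) * u)) * (K (l * (y - u)) : ℂ))) := by
        apply Continuous.tendsto; fun_prop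
      simp only [Complex.ofReal_zero, zero_mul, neg_zero, Complex.exp_zero, mul_one] at this
      exact this.mono_left nhdsWithin_le_nhds
  have hGc : ContinuousOn (fun p : ℝ × ℝ => G (1 + ((p.1:ℂ) + Complex.I * (l * p.2))))
      (Set.Icc 0 1 ×ˢ Set.Icc (-1) 1) := by
    refine G_cont.comp (by fun_prop) ?_
    intro p hp
    have := hp.1.1
    simpa using this
  obtain ⟨M, hM⟩ := (isCompact_Icc.prod isCompact_Icc).exists_bound_of_continuousOn hGc
  have lim2 : Tendsto (fun σ : ℝ => ∫ τ in (-1 : ℝ)..1, ((1 - |τ| : ℝ) : ℂ) * Complex.exp (Complex.I * (τ * (l * y)))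
        * G (1 + (σ + Complex.I * (l * τ)))) (𝓝[>] 0) (𝓝 (∫ τ in (-1 : ℝ)..1, ((1 - |τ| : ℝ) : ℂ) * Complex.exp (Complex.I * (τ * (l * y)))
        * G (1 + (Complex.I * (l * τ))))) := by
    have hmem : ∀ᶠ σ : ℝ in 𝓝[>] 0, σ ∈ Set.Ioc (0:ℝ) 1 := Ioc_mem_nhdsGT one_pos
    refine intervalIntegral.tendsto_integral_filter_of_dominated_convergence (fun _ => M) ?_ ?_ ?_ ?_
    · filter_upwards [hmem] with σ hσ
      rw [Set.uIoc_of_le (by norm_num)]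
      apply ContinuousOn.aestronglyMeasurable _ measurableSet_Ioc
      refine ContinuousOn.mul (by fun_prop) ?_
      exact hGc.comp (f := fun τ : ℝ => (σ, τ)) (by fun_prop)
        (fun τ hτ => ⟨⟨hσ.1.le, hσ.2⟩, ⟨hτ.1.le, hτ.2⟩⟩)
    · filter_upwards [hmem] with σ hσ
      refine ae_of_all _ fun τ hτ => ?_
      rw [Set.uIoc_of_le (by norm_num)] at hτ
      have h1 : |τ| ≤ 1 := abs_le.mpr ⟨hτ.1.le, hτ.2⟩
      have := abs_nonneg τ
      rw [norm_mul, norm_mul, show Complex.I * ((τ : ℂ) * (l * y)) = ((τ * (l * y) : ℝ) : ℂ) * Complex.I by push_cast; ring, Complex.norm_exp_ofReal_mul_I, Complex.norm_real, Real.norm_eq_abs,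
        abs_of_nonneg (by linarith), mul_one]
      have h3 := hM (σ, τ) ⟨⟨hσ.1.le, hσ.2⟩, ⟨hτ.1.le, hτ.2⟩⟩
      simp only at h3
      calc _ ≤ 1 * M := by gcongr; linarith
        _ = M := one_mul _
    · simp
    · refine ae_of_all _ fun τ hτ => ?_
      rw [Set.uIoc_of_le (by norm_num)] at hτ
      refine Tendsto.const_mul _ ?_
      have h4 := hGc (0, τ) ⟨⟨le_rfl, zero_le_one⟩, ⟨hτ.1.le, hτ.2⟩⟩
      have h5 : Tendsto (fun σ : ℝ => (σ, τ)) (𝓝[>] 0) (𝓝[Set.Icc 0 1 ×ˢ Set.Icc (-1) 1] (0, τ)) := by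
        refine tendsto_nhdsWithin_iff.mpr ⟨?_, ?_⟩
        · exact (Continuous.tendsto (by fun_prop) 0 : Tendsto (fun σ : ℝ => (σ, τ)) (𝓝 0) (𝓝 (0, τ))).mono_left nhdsWithin_le_nhds
        · filter_upwards [hmem] with σ hσ
          exact ⟨⟨hσ.1.le, hσ.2⟩, ⟨hτ.1.le, hτ.2⟩⟩
      have h6 := h4.tendsto.comp h5
      simpa [Function.comp_def] using h6
  refine tendsto_nhds_unique lim1 (lim2.congr' ?_)
  filter_upwards [self_mem_nhdsWithin] with σ hσ
  exact (W1 l y hσ).symm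

lemma W3 {l : ℝ} (hl : 0 < l) :
    Tendsto (fun y : ℝ => ∫ u in Set.Ioi (0:ℝ), ((B u : ℂ) - 1) * (K (l * (y - u)) : ℂ))
      atTop (𝓝 0) := by
  have hRL := Real.tendsto_integral_exp_smul_cocompact
    (Set.indicator (Set.Ioc (-1:ℝ) 1)
      (fun τ : ℝ => ((1 - |τ| : ℝ) : ℂ) * G (1 + (Complex.I * (l * τ)))))
  have hw : Tendsto (fun y : ℝ => -(l * y / (2 * Real.pi))) atTop (cocompact ℝ) := by
    refine Tendsto.mono_right ?_ atBot_le_cocompact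
    refine tendsto_neg_atTop_atBot.comp ?_
    exact (tendsto_id.const_mul_atTop hl).atTop_div_const (by positivity)
  refine (hRL.comp hw).congr fun y => ?_
  rw [W2 hl y, intervalIntegral.integral_of_le (by norm_num), ← integral_indicator measurableSet_Ioc]
  refine integral_congr_ae (ae_of_all _ fun τ => ?_)
  simp only
  by_cases hτ : τ ∈ Set.Ioc (-1:ℝ) 1
  · rw [Set.indicator_of_mem hτ, Set.indicator_of_mem hτ, Circle.smul_def, Real.fourierChar_apply, smul_eq_mul]
    have hpi : (Real.pi : ℂ) ≠ 0 := by exact_mod_cast Real.pi_ne_zero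
    have e : Complex.exp (↑(2 * Real.pi * -(τ * -(l * y / (2 * Real.pi)))) * Complex.I)
        = Complex.exp (Complex.I * (τ * (l * y))) := by
      congr 1
      push_cast
      field_simp
    rw [e]; ring
  · rw [Set.indicator_of_notMem hτ, Set.indicator_of_notMem hτ, smul_zero]

lemma W5 {l : ℝ} (hl : 0 < l) :
    Tendsto (fun y : ℝ => ∫ w, B (y - w / l) * K w) atTop (𝓝 (∫ w, K w)) := by
  have hBK : ∀ y, Integrable (fun u => B u * K (l * (y - u))) := fun y =>
    (Kl_int hl y).bdd_mul (c := CB) B_meas.aestronglyMeasurable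
      (ae_of_all _ fun u => by rw [Real.norm_of_nonneg (B_nonneg u)]; exact B_le u)
  -- real version
  have h1 : Tendsto (fun y : ℝ => ∫ u in Set.Ioi (0:ℝ), (B u - 1) * (K (l * (y - u))))
      atTop (𝓝 0) := by
    have := (Complex.continuous_re.tendsto 0).comp (W3 hl)
    rw [Complex.zero_re] at this
    refine this.congr fun y => ?_
    simp only [Function.comp]
    have e : ∀ u, ((B u : ℂ) - 1) * (K (l * (y - u)) : ℂ) = (((B u - 1) * K (l * (y - u)) : ℝ) : ℂ) := by
      intro u; push_cast; ring
    simp only [e]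
    rw [integral_complex_ofReal, Complex.ofReal_re]
  have h2 : Tendsto (fun y : ℝ => ∫ u in Set.Ioi (0:ℝ), (K (l * (y - u))))
      atTop (𝓝 (∫ u, K (l * u))) := by
    have hI : Integrable (fun u => K (l * u)) := K_int.comp_mul_left' hl.ne'
    have h3 : Tendsto (fun y : ℝ => ∫ v in Set.Iio y, K (l * v)) atTop (𝓝 (∫ u, K (l * u))) :=
      (aecover_Iio tendsto_id).integral_tendsto_of_countably_generated hI
    refine h3.congr fun y => ?_
    rw [← integral_indicator measurableSet_Ioi, ← integral_indicator measurableSet_Iio,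
      ← integral_sub_left_eq_self _ _ y]
    refine integral_congr_ae (ae_of_all _ fun u => ?_)
    simp only [Set.indicator_apply, Set.mem_Iio, Set.mem_Ioi, sub_lt_self_iff]
  have h4 := (h1.add h2).mul_const l
  have eK : (0 + ∫ u, K (l * u)) * l = ∫ w, K w := by
    rw [zero_add, Measure.integral_comp_mul_left, smul_eq_mul, abs_of_pos (inv_pos.mpr hl)]
    field_simp
  rw [eK] at h4
  refine h4.congr fun y => ?_
  rw [← integral_add]
  · have e1 : ∫ u in Set.Ioi (0:ℝ), ((B u - 1) * (K (l * (y - u))) + K (l * (y - u)))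
       = ∫ u, B u * K (l * (y - u)) := by
      rw [← integral_indicator measurableSet_Ioi]
      refine integral_congr_ae (ae_of_all _ fun u => ?_)
      simp only [Set.indicator_apply, Set.mem_Ioi]
      split_ifs with h
      · ring
      · rw [B_zero (not_lt.mp h), zero_mul]
    rw [e1, ← integral_sub_left_eq_self _ _ y]
    simp only [sub_sub_cancel]
    have e2 := Measure.integral_comp_mul_left (fun w => B (y - w / l) * K w) l
    rw [abs_of_pos (inv_pos.mpr hl), smul_eq_mul] at e2
    have e3 : ∀ x, B (y - l * x / l) = B (y - x) := by
      intro x; congr 2; field_simp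
    simp only [e3] at e2
    rw [e2]; field_simp
  · refine (((hBK y).sub (Kl_int hl y)).integrableOn).congr (ae_of_all _ fun u => ?_)
    simp only [Pi.sub_apply]; ring
  · exact (Kl_int hl y).integrableOn

end DelangeAux
end

section

namespace DelangeAux
open MeasureTheory

lemma BK_int {l : ℝ} (y : ℝ) : Integrable (fun w => B (y - w / l) * K w) :=
  K_int.bdd_mul (c := CB) (B_meas.comp (by fun_prop)).aestronglyMeasurable
    (ae_of_all _ fun u => by rw [Real.norm_of_nonneg (B_nonneg _)]; exact B_le _)

/-- Tauberian step, one value of the parameters. -/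
lemma tauber {η δ : ℝ} (hη : 0 < η) (hδ : 0 < δ) :
    ∀ᶠ y : ℝ in atTop,
      B y * Real.exp (-(2 * δ)) * ((∫ w, K w) - η) ≤ (∫ w, K w) + η ∧
      (∫ w, K w) - η ≤ B y * Real.exp (2 * δ) * (∫ w, K w) + CB * η := by
  set c := ∫ w, K w with hc
  have hlim : Tendsto (fun W : ℝ => ∫ w in Set.Icc (-W) W, K w) atTop (𝓝 c) :=
    (aecover_Icc tendsto_neg_atTop_atBot tendsto_id).integral_tendsto_of_countably_generated K_int
  obtain ⟨W, hW, hW0⟩ := ((hlim.eventually (lt_mem_nhds (show c - η < c by linarith))).and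
    (eventually_gt_atTop 0)).exists
  have hl : 0 < W / δ := by positivity
  have hsub : ∀ w ∈ Set.Icc (-W) W, -δ ≤ w / (W / δ) ∧ w / (W / δ) ≤ δ := by
    intro w hw
    rw [le_div_iff₀ hl, div_le_iff₀ hl]
    have : δ * (W / δ) = W := by field_simp
    constructor
    · rw [neg_mul, this]; exact hw.1
    · rw [this]; exact hw.2
  have hsplit : c = (∫ w in Set.Icc (-W) W, K w) + ∫ w in (Set.Icc (-W) W)ᶜ, K w :=
    (integral_add_compl measurableSet_Icc K_int).symm
  have h5 := W5 hl
  have u1 := h5.eventually (gt_mem_nhds (show c < c + η by linarith))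
  have u2 := h5.eventually (lt_mem_nhds (show c - η < c by linarith))
  have s1 : Tendsto (fun y : ℝ => y + δ) atTop atTop := tendsto_atTop_add_const_right _ _ tendsto_id
  have s2 : Tendsto (fun y : ℝ => y - δ) atTop atTop := tendsto_atTop_add_const_right _ _ tendsto_id
  filter_upwards [s1.eventually u1, s2.eventually u2] with y h1 h2
  constructor
  · -- window around y + δ
    refine le_trans ?_ h1.le
    have : ∫ w in Set.Icc (-W) W, B y * Real.exp (-(2 * δ)) * K w
        ≤ ∫ w in Set.Icc (-W) W, B (y + δ - w / (W / δ)) * K w := by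
      refine setIntegral_mono_on (K_int.const_mul _).integrableOn (BK_int _).integrableOn
        measurableSet_Icc fun w hw => ?_
      obtain ⟨a1, a2⟩ := hsub w hw
      refine mul_le_mul_of_nonneg_right ?_ (K_nonneg w)
      refine le_trans ?_ (B_slow (show y ≤ y + δ - w / (W / δ) by linarith))
      refine mul_le_mul_of_nonneg_left (Real.exp_le_exp.mpr ?_) (B_nonneg y)
      linarith
    have h3 : ∫ w in Set.Icc (-W) W, B (y + δ - w / (W / δ)) * K w ≤
        ∫ w, B (y + δ - w / (W / δ)) * K w :=
      setIntegral_le_integral (BK_int _)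
        (ae_of_all _ fun w => mul_nonneg (B_nonneg _) (K_nonneg _))
    rw [integral_const_mul] at this
    refine le_trans ?_ (this.trans h3)
    refine mul_le_mul_of_nonneg_left hW.le ?_
    exact mul_nonneg (B_nonneg y) (Real.exp_pos _).le
  · refine h2.le.trans ?_
    rw [← integral_add_compl measurableSet_Icc (BK_int (l := W / δ) (y - δ)) (s := Set.Icc (-W) W)]
    refine add_le_add ?_ ?_
    · have : ∫ w in Set.Icc (-W) W, B (y - δ - w / (W / δ)) * K w
        ≤ ∫ w in Set.Icc (-W) W, B y * Real.exp (2 * δ) * K w := by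
        refine setIntegral_mono_on (BK_int _).integrableOn (K_int.const_mul _).integrableOn
          measurableSet_Icc fun w hw => ?_
        obtain ⟨a1, a2⟩ := hsub w hw
        refine mul_le_mul_of_nonneg_right ?_ (K_nonneg w)
        have hs := B_slow (show y - δ - w / (W / δ) ≤ y by linarith)
        calc B (y - δ - w / (W / δ)) = B (y - δ - w / (W / δ)) * Real.exp (y - δ - w / (W / δ) - y)
              * Real.exp (-(y - δ - w / (W / δ) - y)) := by
              rw [mul_assoc, ← Real.exp_add]; simp
          _ ≤ B y * Real.exp (2 * δ) := by
              refine mul_le_mul hs (Real.exp_le_exp.mpr (by linarith)) (Real.exp_pos _).le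
                (B_nonneg y)
      rw [integral_const_mul] at this
      refine this.trans ?_
      refine mul_le_mul_of_nonneg_left ?_ (mul_nonneg (B_nonneg y) (Real.exp_pos _).le)
      exact setIntegral_le_integral K_int (ae_of_all _ K_nonneg)
    · have : ∫ w in (Set.Icc (-W) W)ᶜ, B (y - δ - w / (W / δ)) * K w
        ≤ ∫ w in (Set.Icc (-W) W)ᶜ, CB * K w := by
        refine setIntegral_mono_on (BK_int _).integrableOn (K_int.const_mul _).integrableOn
          measurableSet_Icc.compl fun w hw => ?_
        exact mul_le_mul_of_nonneg_right (B_le _) (K_nonneg w)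
      rw [integral_const_mul] at this
      refine this.trans (mul_le_mul_of_nonneg_left ?_ CB_pos.le)
      linarith

lemma B_lim : Tendsto B atTop (𝓝 1) := by
  have hc := K_pos
  set c := ∫ w, K w with hcdef
  rw [tendsto_order]
  constructor
  · intro b hb
    have t : Tendsto (fun η : ℝ => b * Real.exp (2 * η) * c + CB * η - (c - η)) (𝓝[>] 0)
        (𝓝 (b * Real.exp (2 * 0) * c + CB * 0 - (c - 0))) :=
      (Continuous.tendsto (by fun_prop) 0).mono_left nhdsWithin_le_nhds
    have hneg : b * Real.exp (2 * 0) * c + CB * 0 - (c - 0) < 0 := by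
      simp; nlinarith
    obtain ⟨η, h1, h2⟩ := ((t.eventually (gt_mem_nhds hneg)).and self_mem_nhdsWithin).exists
    have h2' : 0 < η := h2
    filter_upwards [tauber h2' h2'] with y hy
    by_contra hcon
    have hle : B y ≤ b := not_lt.mp hcon
    have := hy.2
    have h3 : B y * Real.exp (2 * η) * c ≤ b * Real.exp (2 * η) * c := by gcongr
    linarith
  · intro b hb
    have t : Tendsto (fun η : ℝ => b * Real.exp (-(2 * η)) * (c - η) - (c + η)) (𝓝[>] 0)
        (𝓝 (b * Real.exp (-(2 * 0)) * (c - 0) - (c + 0))) :=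
      (Continuous.tendsto (by fun_prop) 0).mono_left nhdsWithin_le_nhds
    have hpos : 0 < b * Real.exp (-(2 * 0)) * (c - 0) - (c + 0) := by
      simp; nlinarith
    have hlt : ∀ᶠ η : ℝ in 𝓝[>] 0, η < c := nhdsWithin_le_nhds (gt_mem_nhds hc)
    obtain ⟨η, ⟨h1, h4⟩, h2⟩ := (((t.eventually (lt_mem_nhds hpos)).and hlt).and
      self_mem_nhdsWithin).exists
    have h2' : 0 < η := h2
    filter_upwards [tauber h2' h2'] with y hy
    by_contra hcon
    have hle : b ≤ B y := not_lt.mp hcon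
    have := hy.1
    have h5 : 0 ≤ c - η := by linarith
    have h3 : b * Real.exp (-(2 * η)) * (c - η) ≤ B y * Real.exp (-(2 * η)) * (c - η) := by gcongr
    linarith

/-- The prime number theorem. -/
lemma pnt_psi : Tendsto (fun x : ℝ => Chebyshev.psi x / x) atTop (𝓝 1) := by
  refine (B_lim.comp Real.tendsto_log_atTop).congr' ?_
  filter_upwards [eventually_gt_atTop 0] with x hx
  simp only [Function.comp, B]
  rw [Real.exp_neg, Real.exp_log hx, div_eq_mul_inv]

lemma pnt_theta : Tendsto (fun n : ℕ => Chebyshev.theta n / n) atTop (𝓝 1) := by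
  obtain ⟨C, hC⟩ := Chebyshev.psi_sub_theta_le_mul_sqrt
  have h1 := pnt_psi.comp (tendsto_natCast_atTop_atTop (R := ℝ))
  have h2 : Tendsto (fun n : ℕ => Chebyshev.psi n / n - Chebyshev.theta n / n) atTop (𝓝 0) := by
    have h3 : Tendsto (fun n : ℕ => C * (Real.sqrt n)⁻¹) atTop (𝓝 0) := by
      have := ((Real.tendsto_sqrt_atTop.comp (tendsto_natCast_atTop_atTop (R := ℝ))).inv_tendsto_atTop).const_mul C
      simpa using this
    refine squeeze_zero' (Eventually.of_forall fun n => ?_) ?_ h3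
    · rw [← sub_div]
      exact div_nonneg (sub_nonneg.mpr (Chebyshev.theta_le_psi _)) n.cast_nonneg
    · filter_upwards [eventually_gt_atTop 0] with n hn
      have hn' : (0:ℝ) < n := by exact_mod_cast hn
      rw [← sub_div, div_le_iff₀ hn']
      refine (hC n).trans (le_of_eq ?_)
      rw [mul_assoc]; congr 1
      have := Real.mul_self_sqrt hn'.le
      have h0 := Real.sqrt_pos.mpr hn'
      field_simp
      linarith
  have := h1.sub h2
  rw [sub_zero] at this
  refine this.congr fun n => ?_
  simp

end DelangeAux
end

section

namespace DelangeAux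

/-- The final recursion. -/
lemma recursion {R e : ℕ → ℂ} {a : ℂ} (ha1 : ‖a‖ ≤ 1) (ha : a ≠ 1)
    (he : Tendsto e atTop (𝓝 0))
    (hR : ∀ n : ℕ, 2 ≤ n → R (n + 1) = R n * (1 + a * (((n + 1) * Real.log n)⁻¹ : ℝ))
      + e n * ((n + 1 : ℝ)⁻¹ : ℝ)) :
    Tendsto (fun n : ℕ => R n / (Real.log n : ℂ)) atTop (𝓝 0) := by
  have hre : a.re < 1 := by
    have h1 : a.re ≤ 1 := (Complex.re_le_norm a).trans ha1
    rcases lt_or_eq_of_le h1 with h | h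
    · exact h
    · exfalso; apply ha
      have h2 : a.re ^ 2 + a.im ^ 2 ≤ 1 := by
        have := Complex.sq_norm a
        rw [Complex.normSq_apply] at this
        nlinarith [norm_nonneg a]
      have h3 : a.im = 0 := by
        rw [h] at h2; nlinarith [sq_nonneg a.im]
      exact Complex.ext (by simpa using h) (by simpa using h3)
  obtain ⟨ρ, hρ0, hρa, hρ1⟩ : ∃ ρ : ℝ, 0 ≤ ρ ∧ a.re < ρ ∧ ρ < 1 := by
    refine ⟨(1 + max a.re 0) / 2, ?_, ?_, ?_⟩
    · have := le_max_right a.re 0; linarith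
    · have := le_max_left a.re 0
      have := le_max_right a.re 0
      linarith
    · have : max a.re 0 < 1 := max_lt hre one_pos
      linarith
  have hnorm : ∀ h : ℝ, 0 ≤ h → h ≤ 2 * (ρ - a.re) → ‖1 + a * (h : ℂ)‖ ≤ 1 + ρ * h := by
    intro h h0 h1
    refine abs_le_of_sq_le_sq' ?_ (by positivity) |>.2
    have e1 : ‖1 + a * (h : ℂ)‖ ^ 2 = 1 + 2 * a.re * h + ‖a‖ ^ 2 * h ^ 2 := by
      rw [Complex.sq_norm, Complex.sq_norm, Complex.normSq_apply, Complex.normSq_apply]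
      simp
      ring
    rw [e1]
    have : ‖a‖ ^ 2 ≤ 1 := by nlinarith [norm_nonneg a]
    nlinarith [sq_nonneg (ρ * h), mul_nonneg h0 h0, mul_le_mul_of_nonneg_left h1 h0]
  set κ := 1 - ρ with hκ
  have hκ0 : 0 < κ := by linarith
  have hlog : Tendsto (fun n : ℕ => Real.log n) atTop atTop :=
    Real.tendsto_log_atTop.comp tendsto_natCast_atTop_atTop
  have hh : Tendsto (fun n : ℕ => (((n + 1 : ℝ) * Real.log n)⁻¹ : ℝ)) atTop (𝓝 0) := by
    apply Tendsto.inv_tendsto_atTop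
    exact (tendsto_atTop_add_const_right _ _ tendsto_natCast_atTop_atTop).atTop_mul_atTop₀ hlog
  rw [tendsto_zero_iff_norm_tendsto_zero]
  have key : ∀ ε : ℝ, 0 < ε → ∀ᶠ n : ℕ in atTop, ‖R n / (Real.log n : ℂ)‖ < ε / κ + ε := by
    intro ε hε
    have ev1 : ∀ᶠ n : ℕ in atTop, ((n + 1 : ℝ) * Real.log n)⁻¹ ≤ 2 * (ρ - a.re) :=
      hh.eventually (ge_mem_nhds (by linarith))
    have ev2 : ∀ᶠ n : ℕ in atTop, ‖e n‖ ≤ ε :=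
      (tendsto_zero_iff_norm_tendsto_zero.mp he).eventually (ge_mem_nhds hε)
    have ev3 : ∀ᶠ n : ℕ in atTop, 1 ≤ Real.log n := hlog.eventually_ge_atTop 1
    obtain ⟨n0, hn0⟩ := eventually_atTop.mp ((ev1.and ev2).and (ev3.and (eventually_ge_atTop 2)))
    set P : ℕ → ℝ := fun n => max (‖R n‖ / Real.log n - ε / κ) 0 with hP
    have step : ∀ n ≥ n0, P (n + 1) ≤ P n *
        Real.exp (-κ * (Real.log (Real.log (n + 2)) - Real.log (Real.log (n + 1)))) := by
      intro n hn
      obtain ⟨⟨h1, h2⟩, h3, h4⟩ := hn0 n hn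
      have hn2 : (2:ℝ) ≤ n := by exact_mod_cast h4
      have hlog1 : Real.log n ≤ Real.log (n + 1) := Real.log_le_log (by linarith) (by linarith)
      have hlog2 : Real.log (n + 1) ≤ Real.log (n + 2) :=
        Real.log_le_log (by linarith) (by linarith)
      have hdiff : ((n:ℝ) + 1)⁻¹ ≤ Real.log (n + 1) - Real.log n := by
        have := Real.one_sub_inv_le_log_of_pos (x := ((n:ℝ) + 1) / n) (by positivity)
        rw [Real.log_div (by positivity) (by positivity)] at this
        refine le_trans (le_of_eq ?_) this
        field_simp; ring
      have hdiff2 : Real.log (n + 2) - Real.log (n + 1) ≤ ((n:ℝ) + 1)⁻¹ := by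
        have := Real.log_le_sub_one_of_pos (x := ((n:ℝ) + 2) / (n + 1)) (by positivity)
        rw [Real.log_div (by positivity) (by positivity)] at this
        refine this.trans (le_of_eq ?_)
        field_simp; ring
      set L := Real.log (n + 1) with hL
      have hLpos : 1 ≤ L := h3.trans hlog1
      set q := ((n:ℝ) + 1)⁻¹ with hq
      have hq0 : 0 < q := by positivity
      have hq1 : q ≤ 1 := by
        rw [hq]; exact inv_le_one_of_one_le₀ (by linarith)
      set c := κ * q / L with hc
      have hc1 : c ≤ 1 := by
        rw [hc, div_le_one (by linarith)]; nlinarith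
      have hRn : ‖R (n + 1)‖ ≤ (1 + ρ * ((n + 1 : ℝ) * Real.log n)⁻¹) * ‖R n‖ + ε * q := by
        rw [hR n h4]
        refine (norm_add_le _ _).trans ?_
        rw [norm_mul, norm_mul, Complex.norm_real, Real.norm_of_nonneg hq0.le]
        have := hnorm _ (by positivity) h1
        rw [mul_comm]
        gcongr
      have hloglog : Real.log (Real.log (n + 2)) - Real.log L ≤ q / L := by
        rw [← Real.log_div (by linarith) (by linarith)]
        refine (Real.log_le_sub_one_of_pos (div_pos (by linarith) (by linarith))).trans ?_
        rw [div_sub_one (by linarith)]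
        gcongr
      have hexp : 1 - c ≤ Real.exp (-κ * (Real.log (Real.log (n + 2)) - Real.log L)) := by
        have h5 := Real.add_one_le_exp (-c)
        have h6 : Real.exp (-c) ≤ Real.exp (-κ * (Real.log (Real.log (n + 2)) - Real.log L)) := by
          apply Real.exp_le_exp.mpr
          rw [hc, mul_div_assoc]
          nlinarith
        linarith
      refine le_trans ?_ (mul_le_mul_of_nonneg_left hexp (le_max_right _ _))
      refine max_le ?_ (mul_nonneg (le_max_right _ _) (by linarith))
      refine le_trans ?_ (mul_le_mul_of_nonneg_right (le_max_left _ _) (by linarith))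
      push_cast
      rw [← hL]
      have hl0 : 0 < Real.log n := by linarith
      set D := ‖R n‖ / Real.log n with hD
      have hRD : ‖R n‖ = D * Real.log n := by rw [hD]; field_simp
      have hD0 : 0 ≤ D := by positivity
      have h7 : ‖R (n + 1)‖ ≤ D * (Real.log n + ρ * q) + ε * q := by
        refine hRn.trans (le_of_eq ?_)
        rw [hRD, hq]; field_simp
      have h8 : ‖R (n + 1)‖ ≤ D * (L - κ * q) + ε * q := by
        refine h7.trans ?_
        have : Real.log n + ρ * q ≤ L - κ * q := by
          rw [hκ]; linarith
        nlinarith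
      have h9 : ‖R (n + 1)‖ / L ≤ (D * (L - κ * q) + ε * q) / L := by gcongr
      refine (sub_le_sub_right h9 _).trans (le_of_eq ?_)
      rw [hc]; field_simp; ring
    have hind : ∀ n ≥ n0, P n ≤ P n0 *
        Real.exp (-κ * (Real.log (Real.log (n + 1)) - Real.log (Real.log (n0 + 1)))) := by
      intro n hn
      induction n, hn using Nat.le_induction with
      | base => simp
      | succ n hn ih =>
        refine (step n hn).trans ?_
        refine (mul_le_mul_of_nonneg_right ih (Real.exp_pos _).le).trans (le_of_eq ?_)
        rw [mul_assoc, ← Real.exp_add]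
        push_cast
        rw [show (n:ℝ) + 1 + 1 = n + 2 by ring]
        ring_nf
    have hll : Tendsto (fun n : ℕ => Real.log (Real.log ((n:ℝ) + 1))) atTop atTop :=
      Real.tendsto_log_atTop.comp (Real.tendsto_log_atTop.comp
        (tendsto_atTop_add_const_right _ _ tendsto_natCast_atTop_atTop))
    have hlim : Tendsto (fun n : ℕ => P n0 *
        Real.exp (-κ * (Real.log (Real.log (n + 1)) - Real.log (Real.log (n0 + 1))))) atTop
        (𝓝 (P n0 * 0)) := by
      refine Tendsto.const_mul _ (Real.tendsto_exp_atBot.comp ?_)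
      refine Tendsto.const_mul_atTop_of_neg (by linarith) ?_
      exact tendsto_atTop_add_const_right _ _ hll
    rw [mul_zero] at hlim
    filter_upwards [hlim.eventually (gt_mem_nhds hε), eventually_ge_atTop n0] with n h1 h2
    have h3 := (hind n h2).trans_lt h1
    have h4 : ‖R n‖ / Real.log n - ε / κ < ε := (le_max_left _ _).trans_lt h3
    have h5 := (hn0 n h2).2.1
    rw [norm_div, Complex.norm_real, Real.norm_of_nonneg (by linarith)]
    linarith
  rw [tendsto_order]
  refine ⟨fun b hb => Eventually.of_forall fun n => hb.trans_le (norm_nonneg _), fun b hb => ?_⟩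
  have hε : 0 < b * κ / (1 + κ) := by positivity
  filter_upwards [key _ hε] with n hn
  refine hn.trans_eq ?_
  field_simp

end DelangeAux
end

section

namespace DelangeAux

lemma eps_form {f : ℕ → ℂ} {w : ℕ → ℝ} (hw : ∀ n, 0 ≤ w n)
    (h : ∀ᶠ n in atTop, ‖f n‖ ≤ w n) : ∃ C : ℝ, 0 ≤ C ∧ ∀ n, ‖f n‖ ≤ w n + C := by
  obtain ⟨N, hN⟩ := eventually_atTop.mp h
  refine ⟨∑ k ∈ range N, ‖f k‖, sum_nonneg fun _ _ => norm_nonneg _, fun n => ?_⟩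
  by_cases hn : N ≤ n
  · have := hN n hn
    have : 0 ≤ ∑ k ∈ range N, ‖f k‖ := sum_nonneg fun _ _ => norm_nonneg _
    linarith
  · have := single_le_sum (f := fun k => ‖f k‖) (s := range N) (fun _ _ => norm_nonneg _)
      (mem_range.mpr (not_le.mp hn))
    have := hw n
    linarith

lemma abel_bound (h : ℕ → ℂ) (M : ℝ) (N : ℕ) (hN : 1 ≤ N)
    (hM : ∀ k, k ≤ N → ‖∑ n ∈ Icc 1 k, h n‖ ≤ M) :
    ‖∑ n ∈ Icc 1 N, h n * (Real.log n : ℂ)‖ ≤ 2 * M * Real.log N := by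
  have key : ∀ k, 1 ≤ k → k ≤ N → ‖∑ n ∈ Icc 1 k, h n * (Real.log n : ℂ) -
      (∑ n ∈ Icc 1 k, h n) * (Real.log k : ℂ)‖ ≤ M * Real.log k := by
    intro k hk
    induction k, hk using Nat.le_induction with
    | base => intro _; simp
    | succ k hk ih =>
      intro hkN
      have ih := ih (by omega)
      have hM' := hM k (by omega)
      rw [sum_Icc_succ_top (by omega), sum_Icc_succ_top (by omega)]
      have e : ∑ n ∈ Icc 1 k, h n * (Real.log n : ℂ) + h (k + 1) * (Real.log ((k + 1 : ℕ) : ℝ) : ℂ)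
          - (∑ n ∈ Icc 1 k, h n + h (k + 1)) * (Real.log ((k + 1 : ℕ) : ℝ) : ℂ)
          = (∑ n ∈ Icc 1 k, h n * (Real.log n : ℂ) -
            (∑ n ∈ Icc 1 k, h n) * (Real.log k : ℂ)) -
            (∑ n ∈ Icc 1 k, h n) * ((Real.log ((k + 1 : ℕ) : ℝ) - Real.log k : ℝ) : ℂ) := by
        push_cast; ring
      rw [e]
      refine (norm_sub_le _ _).trans ?_
      have hk0 : (0:ℝ) < k := by exact_mod_cast hk
      have hl : 0 ≤ Real.log ((k + 1 : ℕ) : ℝ) - Real.log k :=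
        sub_nonneg.mpr (Real.log_le_log hk0 (by push_cast; linarith))
      rw [norm_mul, Complex.norm_real, Real.norm_of_nonneg hl]
      nlinarith [mul_le_mul_of_nonneg_right hM' hl]
  have h1 := key N hN le_rfl
  have h2 := hM N le_rfl
  have hl : 0 ≤ Real.log (N:ℝ) := Real.log_nonneg (by exact_mod_cast hN)
  have h3 : ‖(∑ n ∈ Icc 1 N, h n) * (Real.log N : ℂ)‖ ≤ M * Real.log N := by
    rw [norm_mul, Complex.norm_real, Real.norm_of_nonneg hl]
    gcongr
  have h4 := norm_add_le (∑ n ∈ Icc 1 N, h n * (Real.log n : ℂ) -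
      (∑ n ∈ Icc 1 N, h n) * (Real.log N : ℂ)) ((∑ n ∈ Icc 1 N, h n) * (Real.log N : ℂ))
  rw [sub_add_cancel] at h4
  linarith

lemma card_primes (N : ℕ) : ((Icc 1 N).filter Nat.Prime).card = Nat.primeCounting N := by
  rw [Nat.primeCounting, Nat.primeCounting', Nat.count_eq_card_filter_range]
  congr 1
  ext p
  simp only [mem_filter, mem_Icc, mem_range]
  constructor
  · rintro ⟨h, hp⟩; exact ⟨by omega, hp⟩
  · rintro ⟨h, hp⟩; exact ⟨⟨hp.one_le, by omega⟩, hp⟩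

lemma pi_log_le : ∀ᶠ N : ℕ in atTop, (Nat.primeCounting N : ℝ) * Real.log N ≤ 3 * N := by
  have h := (tendsto_natCast_atTop_atTop (R := ℝ)).eventually
    (Chebyshev.eventually_primeCounting_le one_pos)
  filter_upwards [h, eventually_ge_atTop 2] with N hN h2
  rw [Nat.floor_natCast] at hN
  have h2' : (2:ℝ) ≤ N := by exact_mod_cast h2
  have hl : 0 < Real.log (N:ℝ) := Real.log_pos (by linarith)
  rw [le_div_iff₀ hl] at hN
  refine hN.trans ?_
  have : Real.log 4 ≤ 2 := by
    rw [show (4:ℝ) = 2 ^ 2 by norm_num, Real.log_pow]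
    have := Real.log_two_lt_d9
    push_cast; linarith
  nlinarith

/-- weighted sum over primes -/
noncomputable def T (g : ℕ → ℂ) (N : ℕ) : ℂ :=
  ∑ p ∈ (Icc 1 N).filter Nat.Prime, g p * (Real.log p : ℂ)

lemma theta_sum (N : ℕ) :
    ∑ p ∈ (Icc 1 N).filter Nat.Prime, (Real.log p : ℂ) = (Chebyshev.theta N : ℂ) := by
  unfold Chebyshev.theta
  rw [Nat.floor_natCast]
  push_cast
  rfl

lemma norm_a_le {g : ℕ → ℂ} (hbd : ∀ n : ℕ, ‖g n‖ ≤ 1) {a : ℂ}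
    (hprime : Tendsto
      (fun x : ℕ => (∑ p ∈ (Finset.Icc 1 x).filter Nat.Prime, g p) /
        ((Nat.primeCounting x : ℕ) : ℂ)) atTop (𝓝 a)) : ‖a‖ ≤ 1 := by
  refine le_of_tendsto hprime.norm (Eventually.of_forall fun x => ?_)
  rw [norm_div, ← card_primes]
  refine div_le_one_of_le₀ ?_ (norm_nonneg _)
  refine (norm_sum_le _ _).trans ((sum_le_sum fun p _ => hbd p).trans ?_)
  simp

lemma T_bound {g : ℕ → ℂ} (hbd : ∀ n : ℕ, ‖g n‖ ≤ 1) {a : ℂ}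
    (hprime : Tendsto
      (fun x : ℕ => (∑ p ∈ (Finset.Icc 1 x).filter Nat.Prime, g p) /
        ((Nat.primeCounting x : ℕ) : ℂ)) atTop (𝓝 a)) {ε : ℝ} (hε : 0 < ε) :
    ∃ C : ℝ, 0 ≤ C ∧ ∀ N : ℕ, ‖T g N - a * N‖ ≤ ε * N + C := by
  have ha1 := norm_a_le hbd hprime
  refine eps_form (f := fun N : ℕ => T g N - a * N) (w := fun N : ℕ => ε * N)
    (fun n => by positivity) ?_
  set h : ℕ → ℂ := fun n => if n.Prime then g n - a else 0 with hh
  have hsum : ∀ k, ∑ n ∈ Icc 1 k, h n = ∑ p ∈ (Icc 1 k).filter Nat.Prime, g p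
      - a * (Nat.primeCounting k : ℂ) := by
    intro k
    rw [← sum_filter, sum_sub_distrib, sum_const, card_primes, nsmul_eq_mul, mul_comm a]
  have hsum2 : ∀ k, ∑ n ∈ Icc 1 k, h n * (Real.log n : ℂ) = T g k
      - a * (Chebyshev.theta k : ℂ) := by
    intro k
    simp only [hh, ite_mul, zero_mul]
    rw [← sum_filter, ← theta_sum, mul_sum, T, ← sum_sub_distrib]
    exact sum_congr rfl fun p _ => by ring
  set δ := ε / 16 with hδ
  have hδ0 : 0 < δ := by positivity
  obtain ⟨C, hC0, hC⟩ : ∃ C : ℝ, 0 ≤ C ∧ ∀ k, ‖∑ n ∈ Icc 1 k, h n‖ ≤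
      δ * (Nat.primeCounting k : ℝ) + C := by
    refine eps_form (f := fun k => ∑ n ∈ Icc 1 k, h n)
      (w := fun k => δ * (Nat.primeCounting k : ℝ)) (fun n => by positivity) ?_
    have h1 : Tendsto (fun x : ℕ => (∑ p ∈ (Finset.Icc 1 x).filter Nat.Prime, g p) /
        ((Nat.primeCounting x : ℕ) : ℂ) - a) atTop (𝓝 0) := by
      simpa using hprime.sub_const a
    have h2 := (tendsto_zero_iff_norm_tendsto_zero.mp h1).eventually (ge_mem_nhds hδ0)
    filter_upwards [h2, eventually_ge_atTop 2] with k hk hk2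
    have hpos : 0 < Nat.primeCounting k := by
      rw [← card_primes]
      exact card_pos.mpr ⟨2, by simp [hk2, Nat.prime_two]⟩
    have hpos' : (0:ℝ) < Nat.primeCounting k := by exact_mod_cast hpos
    have hne : (Nat.primeCounting k : ℂ) ≠ 0 := by exact_mod_cast hpos.ne'
    rw [hsum k]
    rw [div_sub' hne, norm_div, div_le_iff₀ (by simpa using hpos), Complex.norm_natCast,
      mul_comm _ a] at hk
    exact hk
  have hlogo : ∀ᶠ N : ℕ in atTop, C * Real.log N ≤ δ * N := by
    have h1 := (Real.isLittleO_log_id_atTop.bound (show 0 < δ / (C + 1) by positivity))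
    filter_upwards [(tendsto_natCast_atTop_atTop (R := ℝ)).eventually h1, eventually_ge_atTop 1]
      with N hN hN1
    have hN1' : (1:ℝ) ≤ N := by exact_mod_cast hN1
    have hl : 0 ≤ Real.log (N:ℝ) := Real.log_nonneg hN1'
    rw [Real.norm_of_nonneg hl, id, Real.norm_of_nonneg (by linarith)] at hN
    calc C * Real.log N ≤ (C + 1) * Real.log N := by gcongr; linarith
      _ ≤ (C + 1) * (δ / (C + 1) * N) := by gcongr
      _ = δ * N := by field_simp
  have hth : ∀ᶠ N : ℕ in atTop, |Chebyshev.theta N - N| ≤ δ * N := by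
    have h1 : Tendsto (fun n : ℕ => Chebyshev.theta n / n - 1) atTop (𝓝 0) := by
      simpa using pnt_theta.sub_const 1
    have h2 := (tendsto_zero_iff_norm_tendsto_zero.mp h1).eventually (ge_mem_nhds hδ0)
    filter_upwards [h2, eventually_ge_atTop 1] with N hN hN1
    have hN1' : (0:ℝ) < N := by exact_mod_cast hN1
    rw [div_sub_one hN1'.ne', norm_div, Real.norm_of_nonneg hN1'.le, div_le_iff₀ hN1'] at hN
    exact hN
  filter_upwards [hlogo, hth, pi_log_le, eventually_ge_atTop 1] with N h1 h2 h3 h4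
  have hN1' : (1:ℝ) ≤ N := by exact_mod_cast h4
  have hl : 0 ≤ Real.log (N:ℝ) := Real.log_nonneg hN1'
  have h5 := abel_bound h (δ * (Nat.primeCounting N : ℝ) + C) N h4 (fun k hk => by
    refine (hC k).trans ?_
    have : (Nat.primeCounting k : ℝ) ≤ Nat.primeCounting N := by
      exact_mod_cast Nat.monotone_primeCounting hk
    gcongr)
  rw [hsum2] at h5
  have e : T g N - a * N = (T g N - a * (Chebyshev.theta N : ℂ))
      + a * ((Chebyshev.theta N - N : ℝ) : ℂ) := by push_cast; ring
  rw [e]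
  refine (norm_add_le _ _).trans ?_
  rw [norm_mul, Complex.norm_real, Real.norm_eq_abs]
  have h6 : ‖a‖ * |Chebyshev.theta N - N| ≤ 1 * (δ * N) := by gcongr
  have h7 : δ * ((Nat.primeCounting N : ℝ) * Real.log N) ≤ δ * (3 * N) := by gcongr
  have h8 : δ * 16 = ε := by rw [hδ]; ring
  have h9 : 0 ≤ δ * N := by positivity
  rw [← h8]
  nlinarith

end DelangeAux
end

section

namespace DelangeAux

open ArithmeticFunction in
lemma glog_eq (g : ℕ → ℂ) (N : ℕ) : ∑ n ∈ Icc 1 N, g n * (Real.log n : ℂ) =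
    ∑ d ∈ Icc 1 N, ∑ m ∈ Icc 1 N, if d * m ≤ N then ((vonMangoldt d : ℝ) : ℂ) * g (d * m) else 0 := by
  have e : ∀ n ∈ Icc 1 N, g n * (Real.log n : ℂ) = ∑ d ∈ Icc 1 N, ∑ m ∈ Icc 1 N,
      if d * m = n then ((vonMangoldt d : ℝ) : ℂ) * g (d * m) else 0 := by
    intro n hn
    rw [mem_Icc] at hn
    rw [← vonMangoldt_sum, ← Nat.sum_divisorsAntidiagonal (f := fun i _ => vonMangoldt i)]
    push_cast
    rw [mul_sum, ← sum_product', ← sum_filter]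
    refine sum_congr ?_ ?_
    · ext ⟨d, m⟩
      simp only [Nat.mem_divisorsAntidiagonal, mem_filter, mem_product, mem_Icc]
      constructor
      · rintro ⟨h, h0⟩
        have hd : d ≠ 0 := by rintro rfl; simp at h; omega
        have hm : m ≠ 0 := by rintro rfl; simp at h; omega
        have := Nat.le_mul_of_pos_right d (Nat.pos_of_ne_zero hm)
        have := Nat.le_mul_of_pos_left m (Nat.pos_of_ne_zero hd)
        omega
      · rintro ⟨_, h⟩
        exact ⟨h, by omega⟩
    · rintro ⟨d, m⟩ h
      simp only [mem_filter] at h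
      simp only [h.2]; ring
  rw [sum_congr rfl e, sum_comm]
  refine sum_congr rfl fun d hd => ?_
  rw [sum_comm]
  refine sum_congr rfl fun m hm => ?_
  rw [sum_ite_eq]
  rw [mem_Icc] at hd hm
  have : 1 ≤ d * m := Nat.mul_pos hd.1 hm.1
  simp [mem_Icc, Nat.one_le_iff_ne_zero, show d ≠ 0 by omega, show m ≠ 0 by omega]

lemma gT_eq (g : ℕ → ℂ) (N : ℕ) : ∑ m ∈ Icc 1 N, g m * T g (N / m) =
    ∑ d ∈ Icc 1 N, ∑ m ∈ Icc 1 N, if d * m ≤ N then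
      (if d.Prime then (Real.log d : ℂ) * (g d * g m) else 0) else 0 := by
  rw [sum_comm]
  refine sum_congr rfl fun m hm => ?_
  rw [mem_Icc] at hm
  unfold T
  rw [mul_sum, sum_filter, ← sum_filter]
  rw [← sum_filter, ← sum_filter]
  refine sum_congr ?_ fun d hd => by ring
  ext d
  simp only [mem_filter, mem_Icc, Nat.le_div_iff_mul_le (show 0 < m by omega)]
  constructor
  · rintro ⟨⟨h1, h2⟩, h3⟩
    have := Nat.le_mul_of_pos_right d (show 0 < m by omega)
    exact ⟨⟨⟨h1, by omega⟩, h2⟩, h3⟩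
  · rintro ⟨⟨⟨h1, _⟩, h2⟩, h3⟩
    exact ⟨⟨h1, h2⟩, h3⟩

lemma cnt1 (N d : ℕ) (hd : 1 ≤ d) : ∑ m ∈ Icc 1 N, (if d * m ≤ N then (1:ℝ) else 0) ≤ N * (1 / d) := by
  rw [← sum_filter, sum_const, nsmul_eq_mul, mul_one]
  have : ((Icc 1 N).filter fun m => d * m ≤ N) ⊆ Icc 1 (N / d) := by
    intro m
    simp only [mem_filter, mem_Icc, Nat.le_div_iff_mul_le (show 0 < d by omega)]
    rintro ⟨⟨h1, h2⟩, h3⟩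
    exact ⟨h1, by rwa [mul_comm]⟩
  have h := card_le_card this
  rw [Nat.card_Icc, Nat.add_sub_cancel] at h
  calc _ ≤ ((N / d : ℕ) : ℝ) := by exact_mod_cast h
    _ ≤ N / d := Nat.cast_div_le
    _ = _ := by ring

lemma cnt2 (N d : ℕ) (hd : 1 ≤ d) : ∑ m ∈ Icc 1 N, (if d * m ≤ N then (if d ∣ m then (1:ℝ) else 0) else 0)
    ≤ N * (1 / d ^ 2) := by
  rw [← sum_filter, ← sum_filter, sum_const, nsmul_eq_mul, mul_one]
  have : (((Icc 1 N).filter fun m => d * m ≤ N).filter fun m => d ∣ m) ⊆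
      (Ioc 0 (N / d)).filter fun m => d ∣ m := by
    intro m
    simp only [mem_filter, mem_Icc, mem_Ioc, Nat.le_div_iff_mul_le (show 0 < d by omega)]
    rintro ⟨⟨⟨h1, h2⟩, h3⟩, h4⟩
    exact ⟨⟨h1, by rwa [mul_comm]⟩, h4⟩
  have h := card_le_card this
  rw [Nat.Ioc_filter_dvd_card_eq_div] at h
  have hd' : (0:ℝ) < d := by exact_mod_cast hd
  calc _ ≤ ((N / d / d : ℕ) : ℝ) := by exact_mod_cast h
    _ ≤ ((N / d : ℕ) : ℝ) / d := Nat.cast_div_le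
    _ ≤ ((N : ℝ) / d) / d := by gcongr; exact Nat.cast_div_le
    _ = _ := by field_simp

open ArithmeticFunction in
lemma sumA : ∃ A : ℝ, 0 ≤ A ∧ ∀ N : ℕ, ∑ d ∈ Icc 1 N, (if d.Prime then 0 else vonMangoldt d) * (1 / (d:ℝ)) ≤ A := by
  have h := vonMangoldt.summable_residueClass_non_primes_div (q := 1) 1
  simp only [resid] at h
  have h0 : ∀ n : ℕ, 0 ≤ (if n.Prime then 0 else vonMangoldt n) / (n:ℝ) := by
    intro n
    refine div_nonneg ?_ n.cast_nonneg
    split_ifs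
    exacts [le_rfl, vonMangoldt_nonneg]
  refine ⟨_, tsum_nonneg (L := SummationFilter.unconditional ℕ) h0, fun N => ?_⟩
  refine le_trans (le_of_eq ?_) (h.sum_le_tsum (Icc 1 N) fun n _ => h0 n)
  exact sum_congr rfl fun d _ => by ring

lemma sumB : ∃ B : ℝ, 0 ≤ B ∧ ∀ N : ℕ, ∑ d ∈ Icc 1 N, Real.log d * (1 / (d:ℝ) ^ 2) ≤ B := by
  have h0 : ∀ n : ℕ, 0 ≤ 2 * (1 / (n:ℝ) ^ (3 / 2 : ℝ)) := fun n => by positivity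
  have h : Summable fun n : ℕ => 2 * (1 / (n:ℝ) ^ (3 / 2 : ℝ)) :=
    (Real.summable_one_div_nat_rpow.mpr (by norm_num)).mul_left 2
  refine ⟨_, tsum_nonneg (L := SummationFilter.unconditional ℕ) h0, fun N => ?_⟩
  refine le_trans (sum_le_sum fun d hd => ?_) (h.sum_le_tsum (Icc 1 N) fun n _ => h0 n)
  rw [mem_Icc] at hd
  have hd' : (0:ℝ) < d := by exact_mod_cast hd.1
  have hl := Real.log_le_rpow_div hd'.le (show (0:ℝ) < 1/2 by norm_num)
  have e : (d:ℝ) ^ 2 = (d:ℝ) ^ (1/2:ℝ) * (d:ℝ) ^ (3/2:ℝ) := by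
    rw [← Real.rpow_add hd', ← Real.rpow_natCast]; norm_num
  have hp : 0 < (d:ℝ) ^ (1/2:ℝ) := by positivity
  have hp2 : 0 < (d:ℝ) ^ (3/2:ℝ) := by positivity
  rw [e]
  calc _ ≤ ((d:ℝ) ^ (1/2:ℝ) / (1/2)) * (1 / ((d:ℝ) ^ (1/2:ℝ) * (d:ℝ) ^ (3/2:ℝ))) := by gcongr
    _ = _ := by field_simp

open ArithmeticFunction in
lemma step2 {g : ℕ → ℂ} (hmul : ∀ m n : ℕ, Nat.Coprime m n → g (m * n) = g m * g n)
    (hbd : ∀ n : ℕ, ‖g n‖ ≤ 1) : ∃ C : ℝ, 0 ≤ C ∧ ∀ N : ℕ,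
    ‖∑ n ∈ Icc 1 N, g n * (Real.log n : ℂ) - ∑ m ∈ Icc 1 N, g m * T g (N / m)‖ ≤ C * N := by
  obtain ⟨A, hA0, hA⟩ := sumA
  obtain ⟨B, hB0, hB⟩ := sumB
  refine ⟨A + 2 * B, by positivity, fun N => ?_⟩
  rw [glog_eq, gT_eq, ← sum_sub_distrib]
  have inner : ∀ d ∈ Icc 1 N, ‖(∑ m ∈ Icc 1 N, if d * m ≤ N then ((vonMangoldt d : ℝ) : ℂ) * g (d * m) else 0)
      - ∑ m ∈ Icc 1 N, (if d * m ≤ N then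
      (if d.Prime then (Real.log d : ℂ) * (g d * g m) else 0) else 0)‖ ≤
      N * ((if d.Prime then 0 else vonMangoldt d) * (1 / (d:ℝ))) + 2 * N * (Real.log d * (1 / (d:ℝ) ^ 2)) := by
    intro d hd
    rw [mem_Icc] at hd
    have hlog : 0 ≤ Real.log d := Real.log_natCast_nonneg d
    by_cases hp : d.Prime
    · simp only [hp, if_true]
      rw [← sum_sub_distrib]
      calc _ ≤ ∑ m ∈ Icc 1 N, 2 * Real.log d * (if d * m ≤ N then (if d ∣ m then (1:ℝ) else 0) else 0) := by
            refine norm_sum_le_of_le _ fun m _ => ?_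
            split_ifs with h1 h2
            · rw [vonMangoldt_apply_prime hp, ← mul_sub, norm_mul, Complex.norm_real, Real.norm_of_nonneg hlog]
              have : ‖g (d * m) - g d * g m‖ ≤ 2 := by
                calc _ ≤ ‖g (d * m)‖ + ‖g d‖ * ‖g m‖ := by rw [← norm_mul]; exact norm_sub_le _ _
                  _ ≤ 1 + 1 * 1 := by gcongr <;> exact hbd _
                  _ = 2 := by norm_num
              nlinarith
            · rw [vonMangoldt_apply_prime hp, hmul d m ((Nat.Prime.coprime_iff_not_dvd hp).mpr h2)]
              simp
            · simp
        _ = 2 * Real.log d * ∑ m ∈ Icc 1 N, (if d * m ≤ N then (if d ∣ m then (1:ℝ) else 0) else 0) := by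
            rw [mul_sum]
        _ ≤ 2 * Real.log d * (N * (1 / d ^ 2)) := by gcongr; exact cnt2 N d hd.1
        _ = _ := by ring
    · simp only [hp, if_false]
      have hv : 0 ≤ vonMangoldt d := vonMangoldt_nonneg
      calc _ ≤ ∑ m ∈ Icc 1 N, vonMangoldt d * (if d * m ≤ N then (1:ℝ) else 0) := by
            rw [← sum_sub_distrib]
            refine norm_sum_le_of_le _ fun m _ => ?_
            split_ifs with h1
            · rw [sub_zero, norm_mul, Complex.norm_real, Real.norm_of_nonneg hv]
              gcongr
              exact hbd _
            · simp
        _ = vonMangoldt d * ∑ m ∈ Icc 1 N, (if d * m ≤ N then (1:ℝ) else 0) := by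
            rw [mul_sum]
        _ ≤ vonMangoldt d * (N * (1 / d)) := by gcongr; exact cnt1 N d hd.1
        _ = N * (vonMangoldt d * (1 / d)) := by ring
        _ ≤ _ := le_add_of_nonneg_right (by positivity)
  refine (norm_sum_le_of_le _ inner).trans ?_
  rw [sum_add_distrib, ← mul_sum, ← mul_sum]
  have h1 := hA N
  have h2 := hB N
  have h3 : (0:ℝ) ≤ N := N.cast_nonneg
  nlinarith [mul_le_mul_of_nonneg_left h1 h3, mul_le_mul_of_nonneg_left h2 h3]

lemma step1 {g : ℕ → ℂ} (hbd : ∀ n : ℕ, ‖g n‖ ≤ 1) (N : ℕ) :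
    ‖(∑ n ∈ Icc 1 N, g n) * (Real.log N : ℂ) - ∑ n ∈ Icc 1 N, g n * (Real.log n : ℂ)‖ ≤ N := by
  rw [sum_mul, ← sum_sub_distrib]
  have : ∀ n ∈ Icc 1 N, ‖g n * (Real.log N : ℂ) - g n * (Real.log n : ℂ)‖ ≤ Real.log N - Real.log n := by
    intro n hn
    rw [mem_Icc] at hn
    have : Real.log n ≤ Real.log N :=
      Real.log_le_log (by exact_mod_cast hn.1) (by exact_mod_cast hn.2)
    rw [← mul_sub, norm_mul, ← Complex.ofReal_sub, Complex.norm_real, Real.norm_of_nonneg (by linarith)]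
    nlinarith [hbd n]
  refine (norm_sum_le_of_le _ this).trans ?_
  rcases Nat.eq_zero_or_pos N with rfl | hN
  · simp
  have hN' : (0:ℝ) < N := by exact_mod_cast hN
  rw [sum_sub_distrib, sum_const, Nat.card_Icc, nsmul_eq_mul]
  have e : ∑ n ∈ Icc 1 N, Real.log n = Real.log (N.factorial) := by
    clear this hN hN'
    induction N with
    | zero => simp
    | succ n ih =>
      rw [sum_Icc_succ_top (by omega), ih, Nat.factorial_succ, Nat.cast_mul, Real.log_mul, add_comm]
      · exact_mod_cast (show n + 1 ≠ 0 by omega)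
      · exact_mod_cast n.factorial_ne_zero
  rw [e]
  have h := Real.pow_div_factorial_le_exp (x := N) hN'.le N
  have hf : (0:ℝ) < N.factorial := by exact_mod_cast N.factorial_pos
  have h2 := Real.log_le_log (by positivity) h
  rw [Real.log_exp, Real.log_div (by positivity) hf.ne', Real.log_pow] at h2
  simpa using h2

lemma step3 {g : ℕ → ℂ} (hbd : ∀ n : ℕ, ‖g n‖ ≤ 1) {a : ℂ} (ha1 : ‖a‖ ≤ 1) {ε C : ℝ} (hε : 0 < ε)
    (hT : ∀ N : ℕ, ‖T g N - a * N‖ ≤ ε * N + C) (N : ℕ) :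
    ‖∑ m ∈ Icc 1 N, g m * T g (N / m) - a * N * ∑ m ∈ Icc 1 N, g m / m‖ ≤
      ε * N * (1 + Real.log N) + (C + 1) * N := by
  rw [mul_sum, ← sum_sub_distrib]
  have key : ∀ m ∈ Icc 1 N, ‖g m * T g (N / m) - a * N * (g m / m)‖ ≤ ε * N * (m:ℝ)⁻¹ + (C + 1) := by
    intro m hm
    rw [mem_Icc] at hm
    have hm0 : (0:ℝ) < m := by exact_mod_cast hm.1
    have hmc : (m:ℂ) ≠ 0 := by exact_mod_cast (show m ≠ 0 by omega)
    have e : g m * T g (N / m) - a * N * (g m / m) = g m * ((T g (N / m) - a * ((N / m : ℕ) : ℂ))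
        - a * (((N:ℝ) / m - ((N / m : ℕ) : ℝ) : ℝ) : ℂ)) := by
      push_cast; field_simp; ring
    have hq1 : ((N / m : ℕ) : ℝ) ≤ (N:ℝ) / m := Nat.cast_div_le
    have hq2 : (N:ℝ) / m < ((N / m : ℕ) : ℝ) + 1 := by
      rw [← Nat.floor_div_eq_div (K := ℝ)]; exact Nat.lt_floor_add_one _
    rw [e, norm_mul]
    have h1 : ‖a * (((N:ℝ) / m - ((N / m : ℕ) : ℝ) : ℝ) : ℂ)‖ ≤ 1 := by
      rw [norm_mul, Complex.norm_real, Real.norm_of_nonneg (by linarith)]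
      have := norm_nonneg a
      nlinarith
    have h2 := hT (N / m)
    have h3 : ε * ((N / m : ℕ) : ℝ) ≤ ε * (N / m) := by gcongr
    have h4 := norm_sub_le (T g (N / m) - a * ((N / m : ℕ) : ℂ)) (a * (((N:ℝ) / m - ((N / m : ℕ) : ℝ) : ℝ) : ℂ))
    have h5 : ε * N * (m:ℝ)⁻¹ = ε * (N / m) := by ring
    rw [h5]
    refine (mul_le_of_le_one_left (norm_nonneg _) (hbd m)).trans ?_
    linarith
  refine (norm_sum_le_of_le _ key).trans ?_
  rw [sum_add_distrib, ← mul_sum, sum_const, Nat.card_Icc, nsmul_eq_mul]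
  have h := harmonic_le_one_add_log N
  rw [harmonic_eq_sum_Icc] at h
  push_cast at h
  have hx : ε * N * ∑ i ∈ Icc 1 N, (i:ℝ)⁻¹ ≤ ε * N * (1 + Real.log N) := by gcongr
  simp only [Nat.add_sub_cancel]
  linarith

lemma combine {g : ℕ → ℂ} (hmul : ∀ m n : ℕ, Nat.Coprime m n → g (m * n) = g m * g n)
    (hbd : ∀ n : ℕ, ‖g n‖ ≤ 1) {a : ℂ} (ha1 : ‖a‖ ≤ 1)
    (hT : ∀ ε : ℝ, 0 < ε → ∃ C, 0 ≤ C ∧ ∀ N : ℕ, ‖T g N - a * N‖ ≤ ε * N + C) :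
    Tendsto (fun N : ℕ => (∑ n ∈ Icc 1 N, g n) / N - a * (∑ m ∈ Icc 1 N, g m / m) / (Real.log N : ℂ))
      atTop (𝓝 0) := by
  obtain ⟨C2, hC2, h2⟩ := step2 hmul hbd
  rw [Metric.tendsto_atTop']
  intro ε hε
  obtain ⟨C, hC, h3⟩ := hT (ε / 3) (by positivity)
  have hlog : Tendsto (fun N : ℕ => Real.log N) atTop atTop :=
    Real.tendsto_log_atTop.comp tendsto_natCast_atTop_atTop
  have hev := (hlog.eventually_gt_atTop (3 / ε * (ε + C + 1 + C2 + 1))).and (eventually_ge_atTop 2)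
  obtain ⟨N0, hN0⟩ := eventually_atTop.mp hev
  refine ⟨N0, fun N hN => ?_⟩
  obtain ⟨hl, hN2⟩ := hN0 N hN.le
  have hl0 : 0 < Real.log N := lt_of_le_of_lt (by positivity) hl
  have hNp : (0:ℝ) < N := by exact_mod_cast (show 0 < N by omega)
  have hNc : (N:ℂ) ≠ 0 := by exact_mod_cast hNp.ne'
  have hlc : (Real.log N : ℂ) ≠ 0 := by exact_mod_cast hl0.ne'
  have b1 := step1 hbd N
  have b2 := h2 N
  have b3 := step3 hbd ha1 (by positivity) h3 N
  set S := ∑ n ∈ Icc 1 N, g n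
  set M := ∑ m ∈ Icc 1 N, g m / (m:ℂ)
  set L := ∑ n ∈ Icc 1 N, g n * (Real.log n : ℂ)
  set Q := ∑ m ∈ Icc 1 N, g m * T g (N / m)
  have tot : ‖S * (Real.log N : ℂ) - a * N * M‖ ≤ N + C2 * N + (ε / 3 * N * (1 + Real.log N) + (C + 1) * N) := by
    have : S * (Real.log N : ℂ) - a * N * M = (S * (Real.log N : ℂ) - L) + (L - Q) + (Q - a * N * M) := by ring
    rw [this]
    refine (norm_add₃_le).trans ?_
    linarith
  have e : S / N - a * M / (Real.log N : ℂ) = (S * (Real.log N : ℂ) - a * N * M) / (N * (Real.log N : ℂ)) := by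
    field_simp
  rw [dist_zero_right, e, norm_div, norm_mul, Complex.norm_natCast, Complex.norm_real,
    Real.norm_of_nonneg hl0.le, div_lt_iff₀ (by positivity)]
  refine tot.trans_lt ?_
  have hl' : 3 * (ε + C + 1 + C2 + 1) < ε * Real.log N := by
    have := mul_lt_mul_of_pos_left hl hε
    rw [← mul_assoc, mul_div_cancel₀ _ hε.ne'] at this
    exact this
  have : N + C2 * N + (ε / 3 * N * (1 + Real.log N) + (C + 1) * N) =
      N * (1 + C2 + ε / 3 + ε / 3 * Real.log N + C + 1) := by ring
  rw [this, show ε * (N * Real.log N) = N * (ε * Real.log N) by ring]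
  apply mul_lt_mul_of_pos_left _ hNp
  nlinarith

theorem main
    (g : ℕ → ℂ)
    (hmul : ∀ m n : ℕ, Nat.Coprime m n → g (m * n) = g m * g n)
    (hbd : ∀ n : ℕ, ‖g n‖ ≤ 1)
    (a : ℂ) (ha : a ≠ 1)
    (hprime : Tendsto
      (fun x : ℕ => (∑ p ∈ (Finset.Icc 1 x).filter Nat.Prime, g p) /
        ((Nat.primeCounting x : ℕ) : ℂ)) atTop (𝓝 a)) :
    Tendsto (fun x : ℕ => (∑ n ∈ Finset.Icc 1 x, g n) / (x : ℂ)) atTop (𝓝 0) := by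
  have ha1 := norm_a_le hbd hprime
  have hc := combine hmul hbd ha1 (fun ε hε => T_bound hbd hprime hε)
  set S : ℕ → ℂ := fun N => ∑ n ∈ Icc 1 N, g n with hS
  set R : ℕ → ℂ := fun N => ∑ n ∈ Ico 1 N, S n / ((n:ℂ) * (n + 1)) with hR
  have hRs : ∀ n, 1 ≤ n → R (n + 1) = R n + S n / ((n:ℂ) * (n + 1)) := fun n hn => by
    simp only [hR]; rw [sum_Ico_succ_top hn]
  have hM : ∀ N : ℕ, 1 ≤ N → ∑ m ∈ Icc 1 N, g m / (m:ℂ) = S N / N + R N := by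
    intro N hN
    induction N, hN using Nat.le_induction with
    | base => simp [hS, hR]
    | succ n hn ih =>
      rw [sum_Icc_succ_top (by omega), ih, hRs n hn]
      have : S (n + 1) = S n + g (n + 1) := by simp only [hS]; rw [sum_Icc_succ_top (by omega)]
      rw [this]
      have h1 : (n:ℂ) ≠ 0 := by exact_mod_cast (show n ≠ 0 by omega)
      have h2 : (n:ℂ) + 1 ≠ 0 := by exact_mod_cast (show n + 1 ≠ 0 by omega)
      push_cast
      field_simp
      ring
  have hSb : ∀ N : ℕ, ‖S N / N‖ ≤ 1 := by
    intro N
    rw [norm_div, Complex.norm_natCast]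
    refine div_le_one_of_le₀ ?_ N.cast_nonneg
    refine (norm_sum_le_of_le _ fun n _ => hbd n).trans ?_
    simp
  have hlog : Tendsto (fun N : ℕ => Real.log N) atTop atTop :=
    Real.tendsto_log_atTop.comp tendsto_natCast_atTop_atTop
  have hsm : Tendsto (fun N : ℕ => a * (S N / N) / (Real.log N : ℂ)) atTop (𝓝 0) := by
    refine squeeze_zero_norm' (a := fun N : ℕ => (Real.log N)⁻¹) ?_ hlog.inv_tendsto_atTop
    filter_upwards with N
    have hl0 := Real.log_natCast_nonneg N
    rw [norm_div, norm_mul, Complex.norm_real, Real.norm_of_nonneg hl0, ← one_div]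
    gcongr
    exact mul_le_one₀ ha1 (norm_nonneg _) (hSb N)
  set e : ℕ → ℂ := fun n => S n / n - a * R n / (Real.log n : ℂ) with he
  have het : Tendsto e atTop (𝓝 0) := by
    have := hc.add hsm
    rw [add_zero] at this
    refine this.congr' ?_
    filter_upwards [eventually_ge_atTop 1] with N hN
    rw [hM N hN]
    simp only [he]
    ring
  have hrec := recursion (R := R) (e := e) ha1 ha het (fun n hn => by
    rw [hRs n (by omega)]
    have h1 : (n:ℂ) ≠ 0 := by exact_mod_cast (show n ≠ 0 by omega)
    have h2 : (n:ℂ) + 1 ≠ 0 := by exact_mod_cast (show n + 1 ≠ 0 by omega)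
    have h3 : (Real.log n : ℂ) ≠ 0 := by
      exact_mod_cast (Real.log_pos (by exact_mod_cast (show 1 < n by omega))).ne'
    simp only [he]
    rw [Complex.ofReal_inv, Complex.ofReal_inv, Complex.ofReal_mul]
    rw [Complex.ofReal_add, Complex.ofReal_natCast, Complex.ofReal_one]
    field_simp
    ring)
  have hfin := het.add (hrec.const_mul a)
  rw [mul_zero, add_zero] at hfin
  refine hfin.congr fun n => ?_
  simp only [he]
  ring

end DelangeAux
end


/-- Delange's theorem: a multiplicative function bounded by 1 whose average over primes
tends to some `a ≠ 1` has mean value zero. -/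
theorem delange_theorem
    (g : ℕ → ℂ) (hg1 : g 1 = 1)
    (hmul : ∀ m n : ℕ, Nat.Coprime m n → g (m * n) = g m * g n)
    (hbd : ∀ n : ℕ, ‖g n‖ ≤ 1)
    (a : ℂ) (ha : a ≠ 1)
    (hprime : Tendsto
      (fun x : ℕ => (∑ p ∈ (Finset.Icc 1 x).filter Nat.Prime, g p) /
        ((Nat.primeCounting x : ℕ) : ℂ)) atTop (𝓝 a)) :
    Tendsto (fun x : ℕ => (∑ n ∈ Finset.Icc 1 x, g n) / (x : ℂ)) atTop (𝓝 0) := by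
  exact DelangeAux.main g hmul hbd a ha hprime
end

section
/- Let f: ℕ → {−1, 0, 1} and suppose: (i) the Dirichlet series B(z) = ∑_{n ≡ d mod q} f(n)²/n^z can be written as b/(z−1) + k(z) with b ∈ ℝ and k holomorphic on Re(z) ≥ 1. Then the set {n ∈ ℕ : n ≡ d (mod q), f(n) ≠ 0} has natural density equal to b, i.e. lim_{x→∞} #{n ≤ x : n ≡ d mod q, f(n) ≠ 0}/x = b. -/
open Filter Topology Set Complex

section aux
open MeasureTheory FourierTransform

lemma wi_swap (f g : ℝ → ℂ) (hf : Integrable f) (hg : Integrable g) :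
    ∫ y, 𝓕 f y * g y = ∫ t, f t * 𝓕 g t := by
  have := VectorFourier.integral_fourierIntegral_smul_eq_flip (L := innerₗ ℝ) (μ := volume)
    (ν := volume) (f := f) (g := g) Real.continuous_fourierChar
    (by simp only [innerₗ_apply_apply]; fun_prop) hf hg
  simp only [smul_eq_mul, flip_innerₗ] at this
  exact this

lemma wi_fourier_modulate (φ : ℝ → ℂ) (T t : ℝ) :
    𝓕 (fun y : ℝ => cexp (2 * Real.pi * T * y * I) * φ y) t = 𝓕 φ (t - T) := by
  rw [Real.fourier_real_eq_integral_exp_smul, Real.fourier_real_eq_integral_exp_smul]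
  congr 1
  ext v
  rw [smul_eq_mul, smul_eq_mul, ← mul_assoc, ← Complex.exp_add]
  congr 2
  push_cast
  ring

/-- Smoothed Tauberian statement. -/
lemma wi_smooth (h : ℝ → ℂ) (M : ℝ) (G : ℂ → ℂ) (hm : Measurable h) (hM : ∀ t, ‖h t‖ ≤ M)
    (h0 : ∀ t ≤ 0, h t = 0) (hG : ContinuousOn G {z | 0 ≤ z.re})
    (hL : ∀ s : ℂ, 0 < s.re → ∫ t : ℝ, h t * cexp (-s * t) = G s)
    (φ : SchwartzMap ℝ ℂ) (hφ : HasCompactSupport φ) :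
    Tendsto (fun T : ℝ => ∫ t, h t * (𝓕 φ : SchwartzMap ℝ ℂ) (t - T)) atTop (𝓝 0) := by
  have hM0 : 0 ≤ M := (norm_nonneg _).trans (hM 0)
  -- damped identity
  have key : ∀ ε : ℝ, 0 < ε → ∀ T : ℝ,
      ∫ t : ℝ, (h t * cexp (-ε * t)) * (𝓕 φ : SchwartzMap ℝ ℂ) (t - T)
        = ∫ y : ℝ, G (ε + 2 * Real.pi * y * I) * (cexp (2 * Real.pi * T * y * I) * φ y) := by
    intro ε hε T
    have hint : Integrable (fun t : ℝ => h t * cexp (-ε * t)) := by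
      have h1 : IntegrableOn (fun t : ℝ => M * Real.exp (-ε * t)) (Ioi 0) :=
        (integrableOn_exp_mul_Ioi (by linarith) 0).const_mul M
      rw [← integrable_indicator_iff measurableSet_Ioi] at h1
      refine h1.mono' (by fun_prop) (ae_of_all _ fun t => ?_)
      by_cases ht : 0 < t
      · rw [indicator_of_mem (by exact ht), norm_mul]
        gcongr
        · exact hM t
        · rw [Complex.norm_exp]; simp
      · rw [indicator_of_notMem (by exact ht), h0 t (not_lt.mp ht)]; simp
    have hgi : Integrable (fun y : ℝ => cexp (2 * Real.pi * T * y * I) * φ y) := by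
      refine φ.integrable.norm.mono' (by fun_prop) (ae_of_all _ fun t => ?_)
      rw [norm_mul, Complex.norm_exp]
      simp
    have := wi_swap _ _ hint hgi
    simp only [wi_fourier_modulate] at this
    rw [SchwartzMap.fourier_coe, ← this]
    congr 1
    ext y
    congr 1
    rw [← hL _ (by simp [hε]), Real.fourier_real_eq_integral_exp_smul]
    congr 1
    ext t
    rw [smul_eq_mul, mul_left_comm, ← Complex.exp_add]
    congr 2
    push_cast
    ring
  have key0 : ∀ T : ℝ, ∫ t : ℝ, h t * (𝓕 φ : SchwartzMap ℝ ℂ) (t - T)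
        = ∫ y : ℝ, G (2 * Real.pi * y * I) * (cexp (2 * Real.pi * T * y * I) * φ y) := by
    intro T
    have hl : Tendsto (fun ε : ℝ =>
        ∫ t : ℝ, (h t * cexp (-ε * t)) * (𝓕 φ : SchwartzMap ℝ ℂ) (t - T)) (𝓝[>] 0)
        (𝓝 (∫ t : ℝ, h t * (𝓕 φ : SchwartzMap ℝ ℂ) (t - T))) := by
      refine tendsto_integral_filter_of_dominated_convergence
        (fun t => M * ‖(𝓕 φ : SchwartzMap ℝ ℂ) (t - T)‖) ?_ ?_ ?_ ?_
      · refine Eventually.of_forall fun ε => ?_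
        have : Measurable (fun t : ℝ => (𝓕 φ : SchwartzMap ℝ ℂ) (t - T)) := by
          exact ((𝓕 φ : SchwartzMap ℝ ℂ).continuous.comp (by fun_prop)).measurable
        fun_prop
      · filter_upwards [self_mem_nhdsWithin] with ε hε
        refine ae_of_all _ fun t => ?_
        rw [norm_mul]
        gcongr
        by_cases ht : 0 < t
        · rw [norm_mul, Complex.norm_exp]
          calc _ ≤ M * 1 := by
                gcongr
                · exact hM t
                · have : 0 < ε := hε
                  simp; positivity
            _ = M := mul_one _
        · rw [h0 t (not_lt.mp ht)]; simpa
      · exact (((𝓕 φ : SchwartzMap ℝ ℂ).integrable (μ := volume)).comp_sub_right T).norm.const_mul M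
      · refine ae_of_all _ fun t => ?_
        refine (Continuous.tendsto' (by fun_prop) _ _ (by simp)).mono_left nhdsWithin_le_nhds
    have hr : Tendsto (fun ε : ℝ =>
        ∫ y : ℝ, G (ε + 2 * Real.pi * y * I) * (cexp (2 * Real.pi * T * y * I) * φ y)) (𝓝[>] 0)
        (𝓝 (∫ y : ℝ, G (2 * Real.pi * y * I) * (cexp (2 * Real.pi * T * y * I) * φ y))) := by
      obtain ⟨C, hC⟩ : ∃ C : ℝ, ∀ ε ∈ Icc (0:ℝ) 1, ∀ y ∈ tsupport φ,
          ‖G (ε + 2 * Real.pi * y * I)‖ ≤ C := by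
        have hc : IsCompact (Icc (0:ℝ) 1 ×ˢ tsupport φ) := isCompact_Icc.prod hφ
        have hcont : ContinuousOn (fun p : ℝ × ℝ => G (p.1 + 2 * Real.pi * p.2 * I))
            (Icc (0:ℝ) 1 ×ˢ tsupport φ) := by
          refine hG.comp (by fun_prop) ?_
          rintro ⟨a, b⟩ ⟨ha, hb⟩
          simpa using ha.1
        obtain ⟨C, hC⟩ := hc.exists_bound_of_continuousOn hcont
        exact ⟨C, fun ε hε y hy => hC (ε, y) ⟨hε, hy⟩⟩
      refine tendsto_integral_filter_of_dominated_convergence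
        (fun y => C * ‖φ y‖) ?_ ?_ ?_ ?_
      · filter_upwards [self_mem_nhdsWithin] with ε hε
        have : Continuous (fun y : ℝ => G (ε + 2 * Real.pi * y * I)) := by
          refine hG.comp_continuous (by fun_prop) fun y => ?_
          have : 0 < ε := hε
          simpa using this.le
        exact (this.mul (by fun_prop)).aestronglyMeasurable
      · filter_upwards [Ioo_mem_nhdsGT (zero_lt_one' ℝ)] with ε hε
        refine ae_of_all _ fun y => ?_
        rw [norm_mul, norm_mul, Complex.norm_exp]
        by_cases hy : y ∈ tsupport φ
        · have := hC ε ⟨hε.1.le, hε.2.le⟩ y hy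
          simp only [mul_re, mul_im, ofReal_re, ofReal_im, I_re, I_im]
          norm_num
          gcongr
        · rw [image_eq_zero_of_notMem_tsupport hy]; simp
      · exact (φ.integrable (μ := volume)).norm.const_mul C
      · refine ae_of_all _ fun y => ?_
        refine Tendsto.mul_const _ ?_
        have h1 := hG (2 * Real.pi * y * I) (by simp)
        refine h1.tendsto.comp (tendsto_nhdsWithin_iff.2 ⟨?_, ?_⟩)
        · exact (Continuous.tendsto' (by fun_prop) _ _ (by simp)).mono_left nhdsWithin_le_nhds
        · filter_upwards [self_mem_nhdsWithin] with ε hε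
          have : 0 < ε := hε
          simpa using this.le
    refine tendsto_nhds_unique hl (hr.congr' ?_)
    filter_upwards [self_mem_nhdsWithin] with ε hε
    exact (key ε hε T).symm
  simp_rw [key0]
  have RL := Real.zero_at_infty_fourier (fun y : ℝ => G (2 * Real.pi * y * I) * φ y)
  have hneg : Tendsto (fun T : ℝ => -T) atTop (cocompact ℝ) :=
    tendsto_neg_atTop_atBot.mono_right atBot_le_cocompact
  refine (RL.comp hneg).congr fun T => ?_
  rw [Function.comp_apply, Real.fourier_real_eq_integral_exp_smul]
  congr 1
  ext y
  rw [smul_eq_mul, mul_left_comm]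
  congr 3
  push_cast
  ring

lemma wi_tauber (h : ℝ → ℂ) (M C : ℝ) (G : ℂ → ℂ) (hm : Measurable h) (hM : ∀ t, ‖h t‖ ≤ M)
    (h0 : ∀ t ≤ 0, h t = 0) (hG : ContinuousOn G {z | 0 ≤ z.re})
    (hL : ∀ s : ℂ, 0 < s.re → ∫ t : ℝ, h t * cexp (-s * t) = G s)
    (hC : ∀ t s : ℝ, 1 ≤ t → ‖h t - h s‖ ≤ C * (|t - s| + Real.exp (-t))) :
    Tendsto h atTop (𝓝 0) := by
  have hC0 : 0 ≤ C := by
    have := (norm_nonneg _).trans (hC 1 1 le_rfl)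
    simp only [sub_self, abs_zero, zero_add] at this
    exact nonneg_of_mul_nonneg_left this (Real.exp_pos _)
  obtain ⟨f, -, hf1, hf2, -, hf3⟩ :=
    exists_contDiff_tsupport_subset (E := ℝ) (s := univ) (x := 0) (n := ⊤) univ_mem
  have hc1 : HasCompactSupport (fun x => (f x : ℂ)) := hf1.comp_left (g := fun x : ℝ => (x : ℂ)) (by simp)
  have hc2 : ContDiff ℝ (⊤ : ℕ∞) (fun x => (f x : ℂ)) := Complex.ofRealCLM.contDiff.comp hf2
  let φ : SchwartzMap ℝ ℂ := hc1.toSchwartzMap hc2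
  have hφ : HasCompactSupport φ := hc1
  have hφ0 : φ 0 = 1 := by simp [φ, hf3]
  set K : SchwartzMap ℝ ℂ := 𝓕 φ with hK
  have hKint : ∫ t, K t = 1 := by
    have h1 : 𝓕⁻ K = φ := by simp [hK]
    have h2 := congrArg (fun ψ : SchwartzMap ℝ ℂ => ψ 0) h1
    simp only [hφ0] at h2
    rw [SchwartzMap.fourierInv_coe, Real.fourierInv_eq'] at h2
    simpa using h2
  have hKi : Integrable K := K.integrable
  have hKi1 : Integrable (fun v : ℝ => |v| * ‖K v‖) := by
    simpa using K.integrable_pow_mul volume 1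
  set A := ∫ v : ℝ, |v| * ‖K v‖ with hA
  set B := ∫ v : ℝ, ‖K v‖ with hB
  have hA0 : 0 ≤ A := integral_nonneg fun v => by positivity
  -- rescaled smooth limit
  have lim : ∀ l : ℝ, 0 < l → Tendsto (fun τ : ℝ => ∫ v, h (τ + v / l) * K v) atTop (𝓝 0) := by
    intro l hl
    have h1 := wi_smooth (fun t => h (t / l)) M (fun s => l * G (l * s)) (by fun_prop)
      (fun t => hM _) (fun t ht => h0 _ (div_nonpos_of_nonpos_of_nonneg ht hl.le)) (by
        refine continuousOn_const.mul (hG.comp (by fun_prop) ?_)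
        intro z hz
        have : 0 ≤ z.re := hz
        simp only [mem_ofPred_eq, re_ofReal_mul]
        positivity) (by
        intro s hs
        rw [← hL _ (by rw [re_ofReal_mul]; positivity)]
        have := Measure.integral_comp_div (fun t : ℝ => h t * cexp (-(l * s) * t)) l
        rw [abs_of_pos hl] at this
        rw [← Complex.real_smul, ← this]
        congr 1
        ext t
        congr 2
        push_cast
        have : (l : ℂ) ≠ 0 := by exact_mod_cast hl.ne'
        field_simp) φ hφ
    have h2 : Tendsto (fun τ : ℝ => l * τ) atTop atTop := tendsto_id.const_mul_atTop hl
    refine (h1.comp h2).congr fun τ => ?_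
    rw [Function.comp_apply]
    rw [← integral_add_right_eq_self _ (l * τ)]
    congr 1
    ext v
    congr 2
    · field_simp
      ring
    · ring
  have bound : ∀ l : ℝ, 0 < l → ∀ τ : ℝ, 1 ≤ τ →
      ‖h τ‖ ≤ ‖∫ v, h (τ + v / l) * K v‖ + C * A / l + C * B * Real.exp (-τ) := by
    intro l hl τ hτ
    have i1 : Integrable (fun v => h (τ + v / l) * K v) := by
      refine hKi.bdd_mul (c := M)
        (Measurable.aestronglyMeasurable (by fun_prop)) (ae_of_all _ fun v => hM _)
    have i2 : Integrable (fun v => h τ * K v) := hKi.const_mul _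
    have e1 : h τ = (∫ v, h (τ + v / l) * K v) + ∫ v, (h τ - h (τ + v / l)) * K v := by
      rw [← integral_add i1 (by simp only [sub_mul]; exact i2.sub i1)]
      simp only [sub_mul, add_sub_cancel]
      rw [integral_const_mul, hKint, mul_one]
    have e2 : ‖∫ v, (h τ - h (τ + v / l)) * K v‖ ≤ C * A / l + C * B * Real.exp (-τ) := by
      calc _ ≤ ∫ v, (C / l * (|v| * ‖K v‖) + C * Real.exp (-τ) * ‖K v‖) := by
            refine norm_integral_le_of_norm_le
              ((hKi1.const_mul _).add (hKi.norm.const_mul _)) (ae_of_all _ fun v => ?_)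
            rw [norm_mul]
            calc _ ≤ (C * (|τ - (τ + v / l)| + Real.exp (-τ))) * ‖K v‖ := by
                  gcongr
                  exact hC _ _ hτ
              _ = _ := by
                  rw [sub_add_cancel_left, abs_neg, abs_div, abs_of_pos hl]
                  ring
        _ = _ := by
            rw [integral_add (hKi1.const_mul _) (hKi.norm.const_mul _), integral_const_mul,
              integral_const_mul]
            ring
    have e3 := (congrArg norm e1).trans_le (norm_add_le _ _)
    linarith
  rw [Metric.tendsto_nhds]
  intro ε hε
  let l := 2 * (C * A + 1) / ε
  have hl : 0 < l := by positivity
  have hl2 : C * A / l < ε / 2 := by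
    rw [div_lt_iff₀ hl]
    simp only [l]
    field_simp
    linarith
  have t1 : Tendsto (fun τ : ℝ => ‖∫ v, h (τ + v / l) * K v‖ + C * A / l + C * B * Real.exp (-τ))
      atTop (𝓝 (0 + C * A / l + C * B * 0)) := by
    refine ((tendsto_zero_iff_norm_tendsto_zero.1 (lim l hl)).add_const _).add
      (Tendsto.const_mul _ ?_)
    exact Real.tendsto_exp_neg_atTop_nhds_zero
  have t2 := t1.eventually_lt_const (u := ε) (by linarith)
  filter_upwards [t2, eventually_ge_atTop 1] with τ h1 h2
  rw [dist_zero_right]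
  exact (bound l hl τ h2).trans_lt h1

/-- Oscillation bound for normalized partial sums of a sequence with values in `[0,1]`. -/
lemma wi_osc (a : ℕ → ℝ) (ha0 : ∀ n, 0 ≤ a n) (ha1 : ∀ n, a n ≤ 1) (w u : ℝ) (hwu : w ≤ u) :
    |(∑ k ∈ Finset.Icc 1 ⌊Real.exp u⌋₊, a k) * Real.exp (-u)
      - (∑ k ∈ Finset.Icc 1 ⌊Real.exp w⌋₊, a k) * Real.exp (-w)| ≤ (u - w) + Real.exp (-u) := by
  set Au := ∑ k ∈ Finset.Icc 1 ⌊Real.exp u⌋₊, a k with hAu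
  set Aw := ∑ k ∈ Finset.Icc 1 ⌊Real.exp w⌋₊, a k with hAw
  have hfl : ⌊Real.exp w⌋₊ ≤ ⌊Real.exp u⌋₊ := Nat.floor_mono (Real.exp_le_exp.2 hwu)
  have hsub : Finset.Icc 1 ⌊Real.exp w⌋₊ ⊆ Finset.Icc 1 ⌊Real.exp u⌋₊ :=
    Finset.Icc_subset_Icc_right hfl
  have hle : Aw ≤ Au := Finset.sum_le_sum_of_subset_of_nonneg hsub fun i _ _ => ha0 i
  have hAw0 : 0 ≤ Aw := Finset.sum_nonneg fun i _ => ha0 i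
  have hAw1 : Aw ≤ Real.exp w := by
    calc Aw ≤ ∑ k ∈ Finset.Icc 1 ⌊Real.exp w⌋₊, (1 : ℝ) := Finset.sum_le_sum fun i _ => ha1 i
      _ = ⌊Real.exp w⌋₊ := by simp
      _ ≤ Real.exp w := Nat.floor_le (Real.exp_pos _).le
  have hdiff : Au - Aw ≤ Real.exp u - Real.exp w + 1 := by
    have h1 : Au - Aw = ∑ k ∈ Finset.Icc 1 ⌊Real.exp u⌋₊ \ Finset.Icc 1 ⌊Real.exp w⌋₊, a k := by
      rw [hAu, ← Finset.sum_sdiff hsub]; ring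
    have h2 : ∑ k ∈ Finset.Icc 1 ⌊Real.exp u⌋₊ \ Finset.Icc 1 ⌊Real.exp w⌋₊, a k
        ≤ ∑ k ∈ Finset.Icc 1 ⌊Real.exp u⌋₊ \ Finset.Icc 1 ⌊Real.exp w⌋₊, (1 : ℝ) :=
      Finset.sum_le_sum fun i _ => ha1 i
    have h3 : ∑ k ∈ Finset.Icc 1 ⌊Real.exp u⌋₊ \ Finset.Icc 1 ⌊Real.exp w⌋₊, (1 : ℝ)
        = (⌊Real.exp u⌋₊ : ℝ) - ⌊Real.exp w⌋₊ := by
      rw [Finset.sum_const, Finset.card_sdiff_of_subset hsub]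
      simp [Nat.cast_sub hfl]
    have h4 := Nat.floor_le (Real.exp_pos u).le
    have h5 := Nat.lt_floor_add_one (Real.exp w)
    linarith
  have hexp : 1 - Real.exp w * Real.exp (-u) ≤ u - w := by
    rw [← Real.exp_add]
    have := Real.add_one_le_exp (w + -u)
    linarith
  have eu : Real.exp u * Real.exp (-u) = 1 := by rw [← Real.exp_add]; simp
  have ew : Real.exp w * Real.exp (-w) = 1 := by rw [← Real.exp_add]; simp
  have hpu := Real.exp_pos (-u)
  have hmono : Real.exp (-u) ≤ Real.exp (-w) := Real.exp_le_exp.2 (by linarith)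
  have m1 := mul_le_mul_of_nonneg_right hdiff hpu.le
  have m2 := mul_le_mul_of_nonneg_left hmono hAw0
  have m3 := mul_le_mul_of_nonneg_right hle hpu.le
  have m4 := mul_le_mul_of_nonneg_right hAw1 (sub_nonneg.2 hmono)
  rw [abs_le]
  constructor <;> nlinarith

lemma wi_main (a : ℕ → ℝ) (ha0 : ∀ n, 0 ≤ a n) (ha1 : ∀ n, a n ≤ 1) (b : ℝ) (k : ℂ → ℂ)
    (hk : ContinuousOn k {z : ℂ | 1 ≤ z.re})
    (hB : ∀ z : ℂ, 1 < z.re → LSeries (fun n => (a n : ℂ)) z = b / (z - 1) + k z) :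
    Tendsto (fun x : ℕ => (∑ j ∈ Finset.Icc 1 x, a j) / x) atTop (𝓝 b) := by
  let N : ℝ → ℝ := fun t => (∑ j ∈ Finset.Icc 1 ⌊Real.exp t⌋₊, a j) * Real.exp (-t)
  have hN0 : ∀ t, 0 ≤ N t := fun t =>
    mul_nonneg (Finset.sum_nonneg fun i _ => ha0 i) (Real.exp_pos _).le
  have hsum1 : ∀ n : ℕ, ∑ j ∈ Finset.Icc 1 n, a j ≤ n := fun n => by
    calc _ ≤ ∑ j ∈ Finset.Icc 1 n, (1 : ℝ) := Finset.sum_le_sum fun i _ => ha1 i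
      _ = n := by simp
  have hN1 : ∀ t, N t ≤ 1 := fun t => by
    calc N t ≤ Real.exp t * Real.exp (-t) := by
          refine mul_le_mul_of_nonneg_right ?_ (Real.exp_pos _).le
          exact (hsum1 _).trans (Nat.floor_le (Real.exp_pos _).le)
      _ = 1 := by rw [← Real.exp_add]; simp
  have hNm : Measurable N := by
    have h1 : Measurable (fun n : ℕ => ∑ j ∈ Finset.Icc 1 n, a j) := measurable_from_top
    exact (h1.comp (Nat.measurable_floor.comp Real.measurable_exp)).mul (by fun_prop)
  let h : ℝ → ℂ := fun t => if t ≤ 0 then 0 else ((N t - b : ℝ) : ℂ)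
  have hM : ∀ t, ‖h t‖ ≤ 1 + |b| := by
    intro t
    simp only [h]
    split_ifs
    · simp; positivity
    · rw [Complex.norm_real, Real.norm_eq_abs]
      refine (abs_sub _ _).trans ?_
      rw [abs_of_nonneg (hN0 t)]
      linarith [hN1 t]
  have hO : (fun n ↦ ∑ j ∈ Finset.Icc 1 n, a j) =O[atTop] fun n : ℕ ↦ (n : ℝ) ^ (1 : ℝ) := by
    refine Asymptotics.isBigO_of_le _ fun n => ?_
    rw [Real.rpow_one, Real.norm_of_nonneg (Finset.sum_nonneg fun i _ => ha0 i),
      Real.norm_of_nonneg (Nat.cast_nonneg n)]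
    exact hsum1 n
  have hLap : ∀ s : ℂ, 0 < s.re →
      ∫ t : ℝ, h t * cexp (-s * t) = (k (1 + s) - b) / (1 + s) := by
    intro s hs
    have hs0 : s ≠ 0 := fun h => by simp [h] at hs
    have hs1 : 1 + s ≠ 0 := fun h => by
      have := congrArg Complex.re h
      simp at this; linarith
    have i0 : IntegrableOn (fun t : ℝ => cexp (-s * t)) (Ioi 0) :=
      integrableOn_exp_mul_complex_Ioi (by simpa using hs) 0
    have i1 : IntegrableOn (fun t : ℝ => (N t : ℂ) * cexp (-s * t)) (Ioi 0) := by
      refine Integrable.bdd_mul (c := 1) i0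
        (Measurable.aestronglyMeasurable (by fun_prop)) (ae_of_all _ fun t => ?_)
      rw [Complex.norm_real, Real.norm_of_nonneg (hN0 t)]
      exact hN1 t
    have e0 : ∫ t : ℝ in Ioi 0, cexp (-s * t) = 1 / s := by
      rw [integral_exp_mul_complex_Ioi (by simpa using hs)]
      simp
    have e1 : (1 + s) * ∫ t : ℝ in Ioi 0, (N t : ℂ) * cexp (-s * t) = b / s + k (1 + s) := by
      have h1 := LSeries_eq_mul_integral_of_nonneg a zero_le_one (s := 1 + s) (by simpa using hs)
        hO ha0
      rw [hB _ (by simpa using hs), add_sub_cancel_left] at h1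
      rw [h1, ← Real.exp_zero, ← integral_comp_exp_Ioi]
      congr 1
      refine setIntegral_congr_fun measurableSet_Ioi fun t ht => ?_
      simp only [N]
      rw [Complex.real_smul, Complex.cpow_def_of_ne_zero
        (by exact_mod_cast (Real.exp_pos t).ne'), ← Complex.ofReal_log (Real.exp_pos t).le,
        Real.log_exp]
      push_cast
      rw [mul_left_comm, mul_assoc, ← Complex.exp_add, ← Complex.exp_add]
      congr 2
      ring
    have e2 : ∫ t : ℝ, h t * cexp (-s * t)
        = ∫ t : ℝ in Ioi 0, ((N t : ℂ) * cexp (-s * t) - b * cexp (-s * t)) := by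
      rw [← integral_indicator measurableSet_Ioi]
      congr 1
      ext t
      by_cases ht : 0 < t
      · rw [indicator_of_mem (by exact ht)]
        simp only [h, if_neg (not_le.2 ht)]
        push_cast
        ring
      · rw [indicator_of_notMem (by exact ht)]
        simp [h, not_lt.1 ht]
    rw [e2, integral_sub i1 (i0.const_mul _), integral_const_mul, e0, eq_div_iff hs1, sub_mul,
      mul_comm _ (1 + s), e1]
    field_simp
    ring
  have hlim : Tendsto h atTop (𝓝 0) := by
    refine wi_tauber h (1 + |b|) (2 + |b|) (fun s => (k (1 + s) - b) / (1 + s)) ?_ hM ?_ ?_ hLap ?_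
    · exact Measurable.ite measurableSet_Iic measurable_const (by fun_prop)
    · intro t ht
      simp [h, ht]
    · refine ContinuousOn.div ((hk.comp (by fun_prop) ?_).sub continuousOn_const) (by fun_prop) ?_
      · intro z hz
        have : 0 ≤ z.re := hz
        simpa using this
      · intro z hz h0
        have h1 : 0 ≤ z.re := hz
        have := congrArg Complex.re h0
        simp at this; linarith
    · intro t s ht
      by_cases hs : s ≤ 0
      · have h1 : h s = 0 := by simp [h, hs]
        rw [h1, sub_zero]
        refine (hM t).trans ?_
        have h2 : 1 ≤ |t - s| := by rw [abs_of_nonneg (by linarith)]; linarith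
        have h3 := Real.exp_pos (-t)
        nlinarith [abs_nonneg b]
      · have h1 : ‖h t - h s‖ = |N t - N s| := by
          simp only [h, if_neg hs, if_neg (show ¬ t ≤ 0 by linarith)]
          rw [← Complex.ofReal_sub, Complex.norm_real, Real.norm_eq_abs]
          congr 1; ring
        have h2 : |N t - N s| ≤ |t - s| + Real.exp (-t) := by
          rcases le_total s t with hst | hst
          · have := wi_osc a ha0 ha1 s t hst
            rwa [abs_of_nonneg (show 0 ≤ t - s by linarith)]
          · have := wi_osc a ha0 ha1 t s hst
            rw [abs_sub_comm, abs_sub_comm t s, abs_of_nonneg (show 0 ≤ s - t by linarith)]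
            have h3 : Real.exp (-s) ≤ Real.exp (-t) := Real.exp_le_exp.2 (by linarith)
            exact this.trans (by linarith)
        rw [h1]
        refine h2.trans ?_
        have h3 : 0 ≤ |t - s| + Real.exp (-t) := by positivity
        nlinarith [abs_nonneg b]
  have hlog : Tendsto (fun x : ℕ => Real.log x) atTop atTop :=
    Real.tendsto_log_atTop.comp tendsto_natCast_atTop_atTop
  have h1 := (Complex.continuous_re.tendsto _).comp (hlim.comp hlog)
  have h2 := h1.add_const b
  rw [Complex.zero_re, zero_add] at h2
  refine h2.congr' ?_
  filter_upwards [eventually_ge_atTop 2] with x hx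
  have hx' : (1 : ℝ) < x := by exact_mod_cast hx
  have hp : ¬ Real.log x ≤ 0 := not_le.2 (Real.log_pos hx')
  simp only [Function.comp_apply, h, if_neg hp, Complex.ofReal_re, N]
  rw [Real.exp_neg, Real.exp_log (by linarith), Nat.floor_natCast]
  simp [div_eq_mul_inv]

end aux

/-- Wiener–Ikehara application: if `∑_{n ≡ d mod q} f(n)²/n^z = b/(z-1) + k(z)` with `k`
holomorphic on `Re z ≥ 1`, then `{n ≡ d mod q : f(n) ≠ 0}` has natural density `b`. -/
theorem density_from_wiener_ikehara
    (q d : ℕ) (f : ℕ → ℝ)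
    (hval : ∀ n : ℕ, f n ∈ ({-1, 0, 1} : Set ℝ))
    (b : ℝ) (k : ℂ → ℂ)
    (hk : AnalyticOnNhd ℂ k {z : ℂ | 1 ≤ z.re})
    (hB : ∀ z : ℂ, 1 < z.re →
      ∑' n : {n : ℕ // n ≡ d [MOD q]}, ((f n ^ 2 : ℝ) : ℂ) / ((n : ℕ) : ℂ) ^ z =
        (b : ℂ) / (z - 1) + k z) :
    Tendsto
      (fun x : ℕ => (({n : ℕ | n ≤ x ∧ n ≡ d [MOD q] ∧ f n ≠ 0}.ncard : ℝ)) / x)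
      atTop (𝓝 b) := by
  classical
  let a : ℕ → ℝ := fun n => if n ≡ d [MOD q] ∧ f n ≠ 0 then 1 else 0
  have ha0 : ∀ n, 0 ≤ a n := fun n => by simp only [a]; split_ifs <;> norm_num
  have ha1 : ∀ n, a n ≤ 1 := fun n => by simp only [a]; split_ifs <;> norm_num
  have hsq : ∀ n, n ≡ d [MOD q] → f n ^ 2 = a n := by
    intro n hn
    rcases hval n with h | h | h
    · simp [a, h, hn]
    · simp [a, h]
    · have h : f n = 1 := h
      simp [a, h, hn]
  have main := wi_main a ha0 ha1 b k hk.continuousOn (by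
    intro z hz
    have hz0 : z ≠ 0 := fun h => by simp [h] at hz; linarith
    rw [← hB z hz]
    have h1 := tsum_subtype {n : ℕ | n ≡ d [MOD q]}
      (fun n : ℕ => ((f n ^ 2 : ℝ) : ℂ) / (n : ℂ) ^ z)
    refine Eq.trans ?_ h1.symm
    rw [LSeries]
    congr 1
    ext n
    rw [LSeries.term_def]
    by_cases hn : n ≡ d [MOD q]
    · rw [indicator_of_mem (by exact hn), hsq n hn]
      split_ifs with h0
      · simp [h0, hz0]
      · rfl
    · rw [indicator_of_notMem (by exact hn)]
      simp [a, hn])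
  have hcard : ∀ x : ℕ, ({n : ℕ | n ≤ x ∧ n ≡ d [MOD q] ∧ f n ≠ 0}.ncard : ℝ)
      = a 0 + ∑ j ∈ Finset.Icc 1 x, a j := by
    intro x
    have h1 : {n : ℕ | n ≤ x ∧ n ≡ d [MOD q] ∧ f n ≠ 0}
        = ((Finset.range (x + 1)).filter (fun n => n ≡ d [MOD q] ∧ f n ≠ 0) : Finset ℕ) := by
      ext n
      simp [Nat.lt_succ_iff]
    rw [h1, Set.ncard_coe_finset, Finset.card_filter, Finset.range_eq_Ico,
      Finset.sum_eq_sum_Ico_succ_bot (Nat.succ_pos x)]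
    push_cast
    rfl
  have h0 : Tendsto (fun x : ℕ => a 0 / (x : ℝ)) atTop (𝓝 0) :=
    tendsto_const_div_atTop_nhds_zero_nat _
  have h2 := h0.add main
  rw [zero_add] at h2
  refine h2.congr fun x => ?_
  rw [hcard, add_div]
end
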